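/- arXiv:1212.4346 — 7 statements merged into one kernel-verified Lean document; each statement's English description precedes it below -/
import Mathlib

section
/- Let G be a connected simple graph on a finite vertex set V with Gram matrix K = (L + J)⁻¹. Then for every function u : V → ℝ and every vertex x ∈ V, u(x)² ≤ (max_{y∈V} K_{y,y}) · ‖u‖²_H, where ‖u‖²_H = (Σ_{x∈V} u(x))² + uᵀ L u. -/
open Matrix in
/-- Cauchy–Schwarz inequality for the energy form of a positive definite matrix: point evaluation
at `x` is bounded by the diagonal entry of the inverse matrix. -/
theorem Matrix.PosDef.sq_apply_le_inv_mul {V : Type*} [Fintype V] [DecidableEq V]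
    {M : Matrix V V ℝ} (hM : M.PosDef) (u : V → ℝ) (x : V) :
    u x ^ 2 ≤ M⁻¹ x x * (u ⬝ᵥ M *ᵥ u) := by
  set w : V → ℝ := M⁻¹ *ᵥ Pi.single x 1 with hw
  have hMw : M *ᵥ w = Pi.single x 1 := by
    rw [hw, mulVec_mulVec, mul_nonsing_inv _ ((isUnit_iff_isUnit_det M).mp hM.isUnit), one_mulVec]
  have hwx : w x = M⁻¹ x x := by simp [hw]
  have hsymm : Mᵀ = M := by simpa using hM.isHermitian.eq
  have hwu : w ⬝ᵥ M *ᵥ u = u x := by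
    rw [dotProduct_mulVec, ← mulVec_transpose, hsymm, hMw, single_one_dotProduct]
  have key : ∀ t : ℝ, 0 ≤ M⁻¹ x x * (t * t) + (-2 * u x) * t + u ⬝ᵥ M *ᵥ u := fun t ↦ by
    have h := hM.posSemidef.dotProduct_mulVec_nonneg (u - t • w)
    simp only [star_trivial, mulVec_sub, mulVec_smul, hMw, dotProduct_sub, sub_dotProduct,
      smul_dotProduct, dotProduct_smul, dotProduct_single_one, hwu, hwx, smul_eq_mul,
      Pi.sub_apply, Pi.smul_apply] at h
    linarith
  have h := discrim_le_zero key
  rw [discrim] at h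
  linarith

open Matrix in
theorem SimpleGraph.dotProduct_lapMatrix_add_ones_mulVec {V : Type*} [Fintype V] [DecidableEq V]
    (G : SimpleGraph V) [DecidableRel G.Adj] (u : V → ℝ) :
    u ⬝ᵥ (G.lapMatrix ℝ + Matrix.of fun _ _ ↦ (1 : ℝ)) *ᵥ u =
      (∑ z, u z) ^ 2 + u ⬝ᵥ G.lapMatrix ℝ *ᵥ u := by
  have h : (Matrix.of fun _ _ : V ↦ (1 : ℝ)) *ᵥ u = fun _ ↦ ∑ z, u z := by
    ext
    simp [mulVec, dotProduct]
  rw [add_mulVec, dotProduct_add, h, add_comm]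
  simp [dotProduct, ← Finset.sum_mul, sq]

open Matrix in
theorem SimpleGraph.Connected.posDef_lapMatrix_add_ones {V : Type*} [Fintype V] [DecidableEq V]
    {G : SimpleGraph V} [DecidableRel G.Adj] (hG : G.Connected) :
    (G.lapMatrix ℝ + Matrix.of fun _ _ ↦ (1 : ℝ)).PosDef := by
  refine .of_dotProduct_mulVec_pos ((G.isHermitian_lapMatrix (R := ℝ)).add (by ext; simp)) fun u hu ↦ ?_
  rw [star_trivial, G.dotProduct_lapMatrix_add_ones_mulVec]
  have hL : 0 ≤ u ⬝ᵥ G.lapMatrix ℝ *ᵥ u := by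
    simpa using (G.posSemidef_lapMatrix ℝ).dotProduct_mulVec_nonneg u
  refine (add_nonneg (sq_nonneg _) hL).lt_of_ne fun h ↦ hu ?_
  have hL0 : u ⬝ᵥ G.lapMatrix ℝ *ᵥ u = 0 := by nlinarith [sq_nonneg (∑ z, u z)]
  have hs : ∑ z, u z = 0 := by
    rw [hL0, add_zero] at h
    exact pow_eq_zero_iff two_ne_zero |>.mp h.symm
  have hconst : ∀ i j, u i = u j := fun i j ↦
    (G.lapMatrix_toLinearMap₂'_apply'_eq_zero_iff_forall_reachable u).mp
      (by rwa [toLinearMap₂'_apply']) i j (hG.preconnected i j)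
  have := hG.nonempty
  ext i
  rw [Finset.sum_congr rfl fun j _ ↦ hconst j i] at hs
  simpa using hs

open Matrix in
/-- Discrete Sobolev inequality: for a connected graph `G` with Gram matrix
`K = (L + J)⁻¹`, every `u : V → ℝ` and vertex `x` satisfy
`u(x)² ≤ (max_y K_{y,y}) ‖u‖²_H` where `‖u‖²_H = (Σ u)² + uᵀ L u`. -/
theorem stmt_4 {V : Type*} [Fintype V] [DecidableEq V]
    (G : SimpleGraph V) [DecidableRel G.Adj] (hG : G.Connected)
    (K : Matrix V V ℝ)
    (hK : K = (G.lapMatrix ℝ + Matrix.of fun _ _ => (1 : ℝ))⁻¹)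
    (u : V → ℝ) (x : V) :
    (u x) ^ 2 ≤ (⨆ y : V, K y y) *
      ((∑ z : V, u z) ^ 2 + u ⬝ᵥ ((G.lapMatrix ℝ).mulVec u)) := by
  have hM := hG.posDef_lapMatrix_add_ones
  rw [← G.dotProduct_lapMatrix_add_ones_mulVec]
  have hle : K x x ≤ ⨆ y : V, K y y := le_ciSup (Set.finite_range fun y ↦ K y y).bddAbove x
  have hnonneg : 0 ≤ u ⬝ᵥ (G.lapMatrix ℝ + Matrix.of fun _ _ ↦ (1 : ℝ)) *ᵥ u := by
    simpa only [star_trivial] using hM.posSemidef.dotProduct_mulVec_nonneg u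
  refine le_trans ?_ (mul_le_mul_of_nonneg_right hle hnonneg)
  rw [hK]
  exact hM.sq_apply_le_inv_mul u x
end

section
/- Let G be a connected simple graph on n vertices with Gram matrix K = (L + J)⁻¹. Then 1/nⁿ ≤ det(K) ≤ 1/n². Equality det(K) = 1/n² holds if and only if G is a tree, and equality det(K) = 1/nⁿ holds if and only if G is the complete graph on n vertices. -/
open Matrix

namespace Matrix

variable {m : Type*} [Fintype m] [DecidableEq m]

theorem PosSemidef.one_lt_det_one_add {S : Matrix m m ℝ} (hS : S.PosSemidef) (h0 : S ≠ 0) :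
    1 < (1 + S).det := by
  have hdet : (1 + S).det = ∏ i, (1 + hS.1.eigenvalues i) := by
    have h := congrArg (Polynomial.eval (-1)) hS.1.charpoly_eq
    rw [Matrix.eval_charpoly, Polynomial.eval_prod] at h
    have h1 : (1 + S) = -(Matrix.scalar m (-1 : ℝ) - S) := by
      ext i j
      simp [Matrix.one_apply, Matrix.diagonal_apply]
      split_ifs <;> ring
    rw [h1, det_neg, h, Fintype.card, ← Finset.prod_const, ← Finset.prod_mul_distrib]
    refine Finset.prod_congr rfl fun i _ => ?_
    simp
    ring
  obtain ⟨i, hi⟩ : ∃ i, hS.1.eigenvalues i ≠ 0 := by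
    by_contra! h
    exact h0 (hS.1.eigenvalues_eq_zero_iff.1 (funext h))
  have hnn := hS.eigenvalues_nonneg
  rw [hdet]
  calc (1 : ℝ) = ∏ _i : m, (1 : ℝ) := by simp
    _ < _ := Finset.prod_lt_prod (fun _ _ => one_pos) (fun j _ => by linarith [hnn j])
      ⟨i, Finset.mem_univ i, by linarith [lt_of_le_of_ne (hnn i) hi.symm]⟩

open scoped MatrixOrder Matrix.Norms.L2Operator in
theorem PosDef.det_lt_det_add {A B : Matrix m m ℝ} (hA : A.PosDef) (hB : B.PosSemidef)
    (h0 : B ≠ 0) : A.det < (A + B).det := by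
  obtain ⟨C, rfl⟩ : ∃ C : Matrix m m ℝ, B = Cᴴ * C :=
    CStarAlgebra.nonneg_iff_eq_star_mul_self.1 hB.nonneg
  rw [det_add_mul _ _ ((isUnit_iff_isUnit_det A).1 hA.isUnit)]
  refine lt_mul_of_one_lt_right hA.det_pos
    (PosSemidef.one_lt_det_one_add (hA.inv.posSemidef.mul_mul_conjTranspose_same C) ?_)
  contrapose! h0
  have hC : Cᴴ = 0 := by
    refine Matrix.ext_of_mulVec_single fun i => ?_
    rw [zero_mulVec]
    by_contra hne
    have hpos := hA.inv.dotProduct_mulVec_pos hne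
    rw [star_mulVec, conjTranspose_conjTranspose, mulVec_mulVec, ← dotProduct_mulVec,
      mulVec_mulVec, ← Matrix.mul_assoc, h0] at hpos
    simp at hpos
  rw [hC, Matrix.zero_mul]

theorem eq_of_offDiag_of_mulVec_one {A B : Matrix m m ℝ} (h : ∀ i j, i ≠ j → A i j = B i j)
    (h1 : A *ᵥ 1 = B *ᵥ 1) : A = B := by
  ext i j
  rcases eq_or_ne i j with rfl | hij
  · have hs := congrFun h1 i
    simp only [mulVec, dotProduct_one] at hs
    rw [← Finset.add_sum_erase _ _ (Finset.mem_univ i),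
      ← Finset.add_sum_erase _ (B i) (Finset.mem_univ i),
      Finset.sum_congr rfl fun j hj => h i j (Finset.ne_of_mem_erase hj).symm] at hs
    exact add_right_cancel hs
  · exact h i j hij

end Matrix

namespace SimpleGraph

variable {V : Type*}

theorem Connected.exists_adj_dist_lt {G : SimpleGraph V} (hG : G.Connected) {r v : V}
    (hv : v ≠ r) : ∃ w, G.Adj v w ∧ G.dist w r < G.dist v r := by
  obtain ⟨q, hq⟩ := hG.exists_walk_length_eq_dist v r
  cases q with
  | nil => exact absurd rfl hv
  | cons h q =>
    rw [Walk.length_cons] at hq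
    exact ⟨_, h, by have := dist_le q; omega⟩

theorem IsTree.exists_parent {T : SimpleGraph V} (hT : T.IsTree) (r : V) :
    ∃ p : V → V, (∀ v ≠ r, T.dist (p v) r < T.dist v r) ∧
      ∀ i j, T.Adj i j ↔ (i ≠ r ∧ p i = j) ∨ (j ≠ r ∧ p j = i) := by
  have hex : ∀ v, ∃ w, v ≠ r → T.Adj v w ∧ T.dist w r < T.dist v r := fun v => by
    by_cases hv : v = r
    · exact ⟨v, fun h => absurd hv h⟩
    · obtain ⟨w, hw⟩ := hT.connected.exists_adj_dist_lt hv
      exact ⟨w, fun _ => hw⟩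
  choose p hp using hex
  refine ⟨p, fun v hv => (hp v hv).2, ?_⟩
  let S : SimpleGraph V :=
    { Adj i j := (i ≠ r ∧ p i = j) ∨ (j ≠ r ∧ p j = i)
      symm := ⟨fun i j h => h.symm⟩
      loopless := ⟨fun i h => by
        have := hp i
        grind⟩ }
  have hS : S ≤ T := fun i j h => by
    rcases h with ⟨h, rfl⟩ | ⟨h, rfl⟩
    · exact (hp _ h).1
    · exact (hp _ h).1.symm
  have hreach : ∀ n v, T.dist v r = n → S.Reachable v r := fun n => by
    induction n using Nat.strong_induction_on with
    | _ n ih =>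
      intro v hv
      by_cases hvr : v = r
      · rw [hvr]
      · have hadj : S.Adj v (p v) := Or.inl ⟨hvr, rfl⟩
        exact hadj.reachable.trans (ih _ (hv ▸ (hp v hvr).2) _ rfl)
  have hSc : S.Connected :=
    { preconnected := fun u v => (hreach _ u rfl).trans (hreach _ v rfl).symm
      nonempty := ⟨r⟩ }
  have hTS : T = S := (isTree_iff_minimal_connected.1 hT).eq_of_le hSc hS |>.symm
  intro i j
  rw [hTS]

variable [Fintype V] [DecidableEq V]

theorem posDef_lapMatrix_add_ones (G : SimpleGraph V) [DecidableRel G.Adj] (hG : G.Connected) :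
    (G.lapMatrix ℝ + of fun _ _ => (1 : ℝ)).PosDef := by
  refine .of_dotProduct_mulVec_pos ((G.isHermitian_lapMatrix ℝ).add (by ext; simp)) fun x hx => ?_
  have hJ : star x ⬝ᵥ ((of fun _ _ => (1 : ℝ) : Matrix V V ℝ) *ᵥ x) = (∑ i, x i) ^ 2 := by
    simp [dotProduct, mulVec, ← Finset.sum_mul, sq]
  have hL : 0 ≤ star x ⬝ᵥ (G.lapMatrix ℝ *ᵥ x) :=
    (G.posSemidef_lapMatrix ℝ).dotProduct_mulVec_nonneg x
  rw [add_mulVec, dotProduct_add, hJ]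
  refine lt_of_le_of_ne (by positivity) fun h => hx ?_
  have hL0 : star x ⬝ᵥ (G.lapMatrix ℝ *ᵥ x) = 0 := by nlinarith [sq_nonneg (∑ i, x i)]
  have hs : ∑ i, x i = 0 := by nlinarith
  rw [star_trivial, ← toLinearMap₂'_apply',
    lapMatrix_toLinearMap₂'_apply'_eq_zero_iff_forall_reachable] at hL0
  ext i
  rw [Finset.sum_congr rfl fun j _ => hL0 j i (hG j i)] at hs
  have := hG.nonempty
  simpa using hs

theorem lapMatrix_eq_add_sdiff {G H : SimpleGraph V} [DecidableRel G.Adj] [DecidableRel H.Adj]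
    (h : G ≤ H) : H.lapMatrix ℝ = G.lapMatrix ℝ + (H \ G).lapMatrix ℝ := by
  have key : ∀ i j, (if H.Adj i j then (1 : ℝ) else 0) =
      (if G.Adj i j then 1 else 0) + if (H \ G).Adj i j then 1 else 0 := fun i j => by
    have := @h i j
    by_cases h1 : G.Adj i j <;> by_cases h2 : H.Adj i j <;> simp_all
  ext i j
  simp only [lapMatrix, degMatrix, Matrix.sub_apply, Matrix.add_apply, diagonal_apply, adjMatrix_apply,
    degree_eq_sum_if_adj, key, Finset.sum_add_distrib]
  split_ifs <;> ring

theorem det_lapMatrix_add_ones_lt {G H : SimpleGraph V} [DecidableRel G.Adj] [DecidableRel H.Adj]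
    (hG : G.Connected) (h : G < H) :
    (G.lapMatrix ℝ + of fun _ _ => (1 : ℝ)).det < (H.lapMatrix ℝ + of fun _ _ => (1 : ℝ)).det := by
  rw [lapMatrix_eq_add_sdiff h.le, add_right_comm]
  refine (G.posDef_lapMatrix_add_ones hG).det_lt_det_add (posSemidef_lapMatrix ℝ _) fun h0 => ?_
  refine h.not_ge fun i j hij => ?_
  by_contra hn
  have := congrFun (congrFun h0 i) j
  simp [lapMatrix, degMatrix, hij.ne, hij, hn] at this

theorem det_lapMatrix_top_add_ones [DecidableRel (⊤ : SimpleGraph V).Adj] :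
    ((⊤ : SimpleGraph V).lapMatrix ℝ + of fun _ _ => (1 : ℝ)).det =
      (Fintype.card V : ℝ) ^ Fintype.card V := by
  have h : (⊤ : SimpleGraph V).lapMatrix ℝ + of (fun _ _ => (1 : ℝ)) =
      diagonal fun _ => (Fintype.card V : ℝ) := by
    refine eq_of_offDiag_of_mulVec_one (fun i j hij => ?_) ?_
    · simp [lapMatrix, degMatrix, hij]
    · rw [add_mulVec, Pi.one_def, lapMatrix_mulVec_const_eq_zero]
      ext; simp [mulVec, dotProduct, diagonal_apply]
  simp [h]

section Rooted

/-- The `V × V` matrix of a rooted tree with parent map `p`: the row of the root `r` is constantly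
`1` and the row of `v ≠ r` is `e_v - e_(p v)`. -/
def rootedMatrix (r : V) (p : V → V) : Matrix V V ℝ :=
  of fun v w => if v = r then 1 else (if v = w then 1 else 0) - if p v = w then 1 else 0

/-- The matrix `rootedMatrix r p` with the row of the root replaced by `e_r`. -/
def rootedMatrixAux (r : V) (p : V → V) : Matrix V V ℝ :=
  of fun v w => (if v = w then 1 else 0) - if v ≠ r ∧ p v = w then 1 else 0

variable {r : V} {p : V → V} {d : V → ℕ}

theorem det_rootedMatrixAux (hd : ∀ v ≠ r, d (p v) < d v) : (rootedMatrixAux r p).det = 1 := by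
  have hT : (rootedMatrixAux r p).BlockTriangular (OrderDual.toDual ∘ d) := by
    intro i j hij
    have hij' : d i < d j := hij
    have := hd i
    simp only [rootedMatrixAux, of_apply]
    grind
  rw [hT.det]
  refine Finset.prod_eq_one fun k _ => ?_
  convert det_one (R := ℝ) (n := {a // (OrderDual.toDual ∘ d) a = k})
  ext ⟨i, hi⟩ ⟨j, hj⟩
  have hij : d i = d j := OrderDual.toDual.injective (hi.trans hj.symm)
  have := hd i
  simp only [toSquareBlock_def, of_apply, rootedMatrixAux, one_apply, Subtype.mk.injEq]
  grind

theorem rootedMatrix_eq_mul (r : V) (p : V → V) : rootedMatrix r p = rootedMatrixAux r p *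
    (1 + replicateCol Unit (1 : V → ℝ) * replicateRow Unit (1 - Pi.single r 1 : V → ℝ)) := by
  have h : rootedMatrixAux r p * replicateCol Unit (1 : V → ℝ) =
      replicateCol Unit (Pi.single r 1) := by
    ext v
    by_cases hv : v = r <;> simp [rootedMatrixAux, mul_apply, hv]
  rw [Matrix.mul_add, Matrix.mul_one, ← Matrix.mul_assoc, h]
  ext v w
  simp only [rootedMatrix, rootedMatrixAux, mul_apply, Matrix.add_apply, of_apply,
    replicateCol_apply, replicateRow_apply, Pi.sub_apply, Pi.one_apply, Pi.single_apply,
    Finset.univ_unique, Finset.sum_singleton]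
  grind

theorem det_rootedMatrix (hd : ∀ v ≠ r, d (p v) < d v) :
    (rootedMatrix r p).det = Fintype.card V := by
  rw [rootedMatrix_eq_mul, det_mul, det_rootedMatrixAux hd,
    det_one_add_replicateCol_mul_replicateRow]
  simp [sub_dotProduct]

theorem transpose_mul_rootedMatrix (G : SimpleGraph V) [DecidableRel G.Adj]
    (hd : ∀ v ≠ r, d (p v) < d v)
    (hadj : ∀ i j, G.Adj i j ↔ (i ≠ r ∧ p i = j) ∨ (j ≠ r ∧ p j = i)) :
    (rootedMatrix r p)ᵀ * rootedMatrix r p = G.lapMatrix ℝ + of fun _ _ => (1 : ℝ) := by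
  refine eq_of_offDiag_of_mulVec_one (fun i j hij => ?_) ?_
  · have hterm : ∀ v, rootedMatrix r p v i * rootedMatrix r p v j = (if v = r then 1 else 0) -
        (if v = i then (if i ≠ r ∧ p i = j then 1 else 0) else 0) -
        (if v = j then (if j ≠ r ∧ p j = i then 1 else 0) else 0) := fun v => by
      simp only [rootedMatrix, of_apply]
      grind
    simp only [mul_apply, transpose_apply, hterm, Finset.sum_sub_distrib, Finset.sum_ite_eq',
      Finset.mem_univ, if_true]
    have h1 := hd i
    have h2 := hd j
    simp only [lapMatrix, degMatrix, Matrix.add_apply, Matrix.sub_apply, diagonal_apply_ne _ hij,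
      adjMatrix_apply, hadj, of_apply]
    grind
  · have hN : rootedMatrix r p *ᵥ 1 = Pi.single r (Fintype.card V : ℝ) := by
      ext v
      by_cases hv : v = r <;> simp [rootedMatrix, mulVec, dotProduct, hv]
    rw [← mulVec_mulVec, hN, mulVec_single, add_mulVec, Pi.one_def, lapMatrix_mulVec_const_eq_zero]
    ext
    simp [rootedMatrix, mulVec, dotProduct]

end Rooted

theorem IsTree.det_lapMatrix_add_ones {T : SimpleGraph V} [DecidableRel T.Adj] (hT : T.IsTree) :
    (T.lapMatrix ℝ + of fun _ _ => (1 : ℝ)).det = (Fintype.card V : ℝ) ^ 2 := by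
  obtain ⟨r⟩ := hT.connected.nonempty
  obtain ⟨p, hd, hadj⟩ := hT.exists_parent r
  rw [← T.transpose_mul_rootedMatrix (d := (T.dist · r)) hd hadj, det_mul, det_transpose,
    det_rootedMatrix (d := (T.dist · r)) hd, sq]

end SimpleGraph

open SimpleGraph in
/-- For a connected graph `G` on `n` vertices with Gram matrix `K = (L + J)⁻¹`,
`1/nⁿ ≤ det K ≤ 1/n²`, with `det K = 1/n²` iff `G` is a tree and
`det K = 1/nⁿ` iff `G` is the complete graph. -/
theorem stmt_9 {V : Type*} [Fintype V] [DecidableEq V]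
    (G : SimpleGraph V) [DecidableRel G.Adj] (hG : G.Connected) (n : ℕ)
    (hn : n = Fintype.card V)
    (K : Matrix V V ℝ)
    (hK : K = (G.lapMatrix ℝ + Matrix.of fun _ _ => (1 : ℝ))⁻¹) :
    (1 / (n : ℝ) ^ n ≤ K.det ∧ K.det ≤ 1 / (n : ℝ) ^ 2) ∧
      (K.det = 1 / (n : ℝ) ^ 2 ↔ G.IsTree) ∧
      (K.det = 1 / (n : ℝ) ^ n ↔ G = ⊤) := by
  classical
  have hV := hG.nonempty
  have hn0 : (0 : ℝ) < n := by rw [hn]; exact_mod_cast Fintype.card_pos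
  set M := G.lapMatrix ℝ + Matrix.of fun _ _ => (1 : ℝ) with hM
  have hpos : 0 < M.det := (G.posDef_lapMatrix_add_ones hG).det_pos
  have hdet : K.det = 1 / M.det := by rw [hK, det_nonsing_inv, Ring.inverse_eq_inv', one_div]
  have htop : G ≠ ⊤ → M.det < (n : ℝ) ^ n := fun h => by
    rw [hn, ← det_lapMatrix_top_add_ones]
    exact det_lapMatrix_add_ones_lt hG h.lt_top
  have htop' : G = ⊤ → M.det = (n : ℝ) ^ n := by
    rintro rfl
    rw [hM, hn, det_lapMatrix_top_add_ones]
  have htree : ¬ G.IsTree → (n : ℝ) ^ 2 < M.det := fun h => by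
    obtain ⟨T, hTG, hT⟩ := hG.exists_isTree_le
    rw [hn, ← hT.det_lapMatrix_add_ones]
    exact det_lapMatrix_add_ones_lt hT.connected (lt_of_le_of_ne hTG fun he => h (he ▸ hT))
  have htree' : G.IsTree → M.det = (n : ℝ) ^ 2 := fun h => by rw [hn, h.det_lapMatrix_add_ones]
  have hle_top : M.det ≤ (n : ℝ) ^ n := by
    by_cases h : G = ⊤
    exacts [(htop' h).le, (htop h).le]
  have hle_tree : (n : ℝ) ^ 2 ≤ M.det := by
    by_cases h : G.IsTree
    exacts [(htree' h).ge, (htree h).le]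
  rw [hdet]
  refine ⟨⟨one_div_le_one_div_of_le hpos hle_top,
    one_div_le_one_div_of_le (by positivity) hle_tree⟩, ?_, ?_⟩
  · rw [one_div, one_div, _root_.inv_inj]
    exact ⟨fun h => by_contra fun h' => (htree h').ne' h, htree'⟩
  · rw [one_div, one_div, _root_.inv_inj]
    exact ⟨fun h => by_contra fun h' => (htop h').ne h, htop'⟩
end

section
/- Let G be a connected simple graph on n vertices with Gram matrix K = (L + J)⁻¹. Then for any two vertices i and j, the resistance satisfies r_{i,j} = τ(G;i,j)/τ(G). -/
/-- The number of spanning trees of `G`. -/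
noncomputable def spanningTreeCount {V : Type*} [Fintype V] (G : SimpleGraph V) : ℕ :=
  Nat.card {H : SimpleGraph V // H ≤ G ∧ H.IsTree}

/-- `τ(G;i,j)`: the number of spanning forests of `G` with exactly two connected
components such that `i` and `j` lie in different components. -/
noncomputable def twoForestCount {V : Type*} [Fintype V] (G : SimpleGraph V) (i j : V) : ℕ :=
  Nat.card {H : SimpleGraph V //
    H ≤ G ∧ H.IsAcyclic ∧ Nat.card H.ConnectedComponent = 2 ∧ ¬ H.Reachable i j}

open Finset Matrix

namespace SimpleGraph

variable {V : Type*}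

/-- A vertex joined by a walk to an endpoint of a deleted edge still reaches one of its two
endpoints. -/
lemma Walk.reachable_deleteEdges_or {G : SimpleGraph V} {w v : V} (p : G.Walk w v) (u : V) :
    (G.deleteEdges {s(v, u)}).Reachable w v ∨ (G.deleteEdges {s(v, u)}).Reachable w u := by
  induction p with
  | nil => exact Or.inl .rfl
  | @cons a b c h p ih =>
    by_cases he : s(a, b) = s(c, u)
    · rcases Sym2.eq_iff.mp he with ⟨rfl, -⟩ | ⟨rfl, -⟩
      · exact Or.inl .rfl
      · exact Or.inr .rfl
    · have hab : (G.deleteEdges {s(c, u)}).Reachable a b :=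
        Adj.reachable (deleteEdges_adj.mpr ⟨h, by simpa using he⟩)
      exact ih.imp hab.trans hab.trans

/-- A trail reaches each of its darts, and leaves it, without using the underlying edge. -/
lemma Walk.IsTrail.reachable_deleteEdges_of_mem {G : SimpleGraph V} {i j v u : V}
    {p : G.Walk i j} (hp : p.IsTrail) (h : (v, u) ∈ p.darts.map Dart.toProd) :
    (G.deleteEdges {s(v, u)}).Reachable i v ∧ (G.deleteEdges {s(v, u)}).Reachable j u := by
  induction p with
  | nil => simp at h
  | @cons a b c hab p ih =>
    rw [Walk.isTrail_cons] at hp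
    rw [Walk.darts_cons, List.map_cons, List.mem_cons] at h
    rcases h with h | h
    · obtain ⟨rfl, rfl⟩ := Prod.mk.inj h
      exact ⟨.rfl, (reachable_deleteEdges_iff_exists_walk.mpr ⟨p, hp.2⟩).symm⟩
    · obtain ⟨h1, h2⟩ := ih hp.1 h
      refine ⟨Reachable.trans (Adj.reachable (deleteEdges_adj.mpr ⟨hab, ?_⟩)) h1, h2⟩
      rintro he
      rw [Set.mem_singleton_iff] at he
      obtain ⟨d, hd, hdv⟩ := List.mem_map.mp h
      apply hp.2
      rw [he]
      refine List.mem_map.mpr ⟨d, hd, ?_⟩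
      rw [Dart.edge, hdv]

/-- Deleting the edge `vu` from `T` separates `i` and `v` from `j` and `u`
(when `T` is acyclic): the path from `i` to `j` crosses from `v` to `u`. -/
def Crosses (T : SimpleGraph V) (i j v u : V) : Prop :=
  T.Adj v u ∧ (T.deleteEdges {s(v, u)}).Reachable i v ∧ (T.deleteEdges {s(v, u)}).Reachable j u

lemma IsAcyclic.not_reachable_deleteEdges {T : SimpleGraph V} (hT : T.IsAcyclic) {v u : V}
    (h : T.Adj v u) : ¬ (T.deleteEdges {s(v, u)}).Reachable v u :=
  isBridge_iff.mp (isAcyclic_iff_forall_adj_isBridge.mp hT h)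

lemma IsAcyclic.crosses_iff_mem_darts {T : SimpleGraph V} (hT : T.IsAcyclic) {i j : V}
    {p : T.Walk i j} (hp : p.IsTrail) (v u : V) :
    T.Crosses i j v u ↔ (v, u) ∈ p.darts.map Dart.toProd := by
  constructor
  · rintro ⟨hvu, hi, hj⟩
    have hbr := hT.not_reachable_deleteEdges hvu
    have he : s(v, u) ∈ p.edges := by
      by_contra he
      exact hbr (hi.symm.trans
        ((reachable_deleteEdges_iff_exists_walk.mpr ⟨p, he⟩).trans hj))
    obtain ⟨d, hd, hde⟩ := List.mem_map.mp he
    rcases (dart_edge_eq_mk'_iff.mp hde) with h | h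
    · exact List.mem_map.mpr ⟨d, hd, h⟩
    · have hm : (u, v) ∈ p.darts.map Dart.toProd := List.mem_map.mpr ⟨d, hd, h⟩
      have := (hp.reachable_deleteEdges_of_mem hm).1
      rw [Sym2.eq_swap] at this
      exact absurd (hi.symm.trans this) hbr
  · intro h
    obtain ⟨d, hd, hdv⟩ := List.mem_map.mp h
    have hadj := d.adj
    rw [show d.toProd = (v, u) from hdv] at hadj
    exact ⟨hadj, hp.reachable_deleteEdges_of_mem h⟩

/-- The boundary of a walk from `i` to `j`, as a `1`-chain, is `i - j`. -/
lemma Walk.sum_count_darts_sub [Fintype V] [DecidableEq V] {G : SimpleGraph V} {i j : V}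
    (p : G.Walk i j) (v : V) :
    ∑ u, (((p.darts.map Dart.toProd).count (v, u) : ℝ) - (p.darts.map Dart.toProd).count (u, v))
      = (if i = v then 1 else 0) - (if j = v then 1 else 0) := by
  induction p with
  | nil => simp
  | @cons a b c h p ih =>
    have hsplit : ∀ u, ((((Walk.cons h p).darts.map Dart.toProd).count (v, u) : ℝ)
        - ((Walk.cons h p).darts.map Dart.toProd).count (u, v))
        = (((p.darts.map Dart.toProd).count (v, u) : ℝ) - (p.darts.map Dart.toProd).count (u, v))
          + ((if a = v then if b = u then 1 else 0 else 0)
            - (if b = v then if a = u then 1 else 0 else 0)) := by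
      intro u
      simp only [Walk.darts_cons, List.map_cons, List.count_cons, beq_iff_eq, Prod.mk.injEq]
      push_cast
      simp only [ite_and]
      split_ifs <;> ring
    rw [Finset.sum_congr rfl fun u _ => hsplit u, Finset.sum_add_distrib, ih,
      Finset.sum_sub_distrib]
    have h1 : (∑ u, if a = v then if b = u then (1 : ℝ) else 0 else 0) = if a = v then 1 else 0 := by
      split_ifs <;> simp
    have h2 : (∑ u, if b = v then if a = u then (1 : ℝ) else 0 else 0) = if b = v then 1 else 0 := by
      split_ifs <;> simp
    rw [h1, h2]
    ring

open Classical in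
/-- In a tree, the path from `i` to `j` is a unit flow from `i` to `j`. -/
lemma IsTree.sum_crosses_sub [Fintype V] {T : SimpleGraph V} (hT : T.IsTree) (i j v : V) :
    ∑ u, ((if T.Crosses i j v u then (1 : ℝ) else 0) - (if T.Crosses i j u v then 1 else 0))
      = (if i = v then 1 else 0) - (if j = v then 1 else 0) := by
  obtain ⟨p, hp⟩ := hT.connected.exists_isPath i j
  have hnd : (p.darts.map Dart.toProd).Nodup :=
    (Walk.darts_nodup_of_support_nodup hp.support_nodup).map Dart.toProd_injective
  rw [← p.sum_count_darts_sub v]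
  refine Finset.sum_congr rfl fun u _ => ?_
  simp only [hT.isAcyclic.crosses_iff_mem_darts hp.isTrail, hnd.count, Nat.cast_ite, Nat.cast_one,
    Nat.cast_zero]

/-- `F` is a spanning forest of `G` with two components, separating `i` from `j`. -/
def IsSeparatingForest (G : SimpleGraph V) (i j : V) (F : SimpleGraph V) : Prop :=
  F ≤ G ∧ F.IsAcyclic ∧ Nat.card F.ConnectedComponent = 2 ∧ ¬ F.Reachable i j

lemma card_connectedComponent_eq_two_iff {F : SimpleGraph V} {i j : V} (h : ¬ F.Reachable i j) :
    Nat.card F.ConnectedComponent = 2 ↔ ∀ w, F.Reachable i w ∨ F.Reachable j w := by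
  rw [Nat.card_eq_two_iff' (F.connectedComponentMk i)]
  have hij : F.connectedComponentMk j ≠ F.connectedComponentMk i := fun e =>
    h (ConnectedComponent.exact e).symm
  constructor
  · rintro ⟨c, -, hc⟩ w
    by_cases hw : F.connectedComponentMk w = F.connectedComponentMk i
    · exact Or.inl (ConnectedComponent.exact hw).symm
    · exact Or.inr (ConnectedComponent.exact ((hc _ hij).trans (hc _ hw).symm))
  · refine fun hw => ⟨F.connectedComponentMk j, hij, fun c => ?_⟩
    induction c using ConnectedComponent.ind with | _ w =>
    intro hwi
    rcases hw w with h' | h'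
    · exact absurd (ConnectedComponent.sound h'.symm) hwi
    · exact ConnectedComponent.sound h'.symm

lemma isSeparatingForest_iff {G F : SimpleGraph V} {i j : V} :
    G.IsSeparatingForest i j F ↔
      F ≤ G ∧ F.IsAcyclic ∧ (∀ w, F.Reachable i w ∨ F.Reachable j w) ∧ ¬ F.Reachable i j := by
  unfold IsSeparatingForest
  constructor
  · rintro ⟨h1, h2, h3, h4⟩
    exact ⟨h1, h2, (card_connectedComponent_eq_two_iff h4).mp h3, h4⟩
  · rintro ⟨h1, h2, h3, h4⟩
    exact ⟨h1, h2, (card_connectedComponent_eq_two_iff h4).mpr h3, h4⟩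

lemma deleteEdges_sup_edge_of_not_adj {F : SimpleGraph V} {v u : V} (h : ¬ F.Adj v u) :
    (F ⊔ edge v u).deleteEdges {s(v, u)} = F := by
  ext a b
  simp only [deleteEdges_adj, sup_adj, edge_adj, Set.mem_singleton_iff, Sym2.eq_iff]
  have h' : ¬ F.Adj u v := fun e => h e.symm
  constructor
  · rintro ⟨h1 | h1, h2⟩
    · exact h1
    · exact absurd h1.1 h2
  · intro hab
    refine ⟨Or.inl hab, ?_⟩
    rintro (⟨rfl, rfl⟩ | ⟨rfl, rfl⟩) <;> contradiction

lemma deleteEdges_sup_edge_of_adj {T : SimpleGraph V} {v u : V} (h : T.Adj v u) :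
    T.deleteEdges {s(v, u)} ⊔ edge v u = T := by
  ext a b
  simp only [deleteEdges_adj, sup_adj, edge_adj, Set.mem_singleton_iff, Sym2.eq_iff]
  constructor
  · rintro (h1 | ⟨⟨rfl, rfl⟩ | ⟨rfl, rfl⟩, -⟩)
    · exact h1.1
    · exact h
    · exact h.symm
  · intro hab
    by_cases he : a = v ∧ b = u ∨ a = u ∧ b = v
    · exact Or.inr ⟨he, hab.ne⟩
    · exact Or.inl ⟨hab, he⟩

lemma IsSeparatingForest.isTree_sup_edge {G F : SimpleGraph V} {i j v u : V}
    (hF : G.IsSeparatingForest i j F) (hi : F.Reachable i v) (hj : F.Reachable j u) :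
    (F ⊔ edge v u).IsTree := by
  obtain ⟨-, hac, hw, hij⟩ := isSeparatingForest_iff.mp hF
  have hvu : ¬ F.Reachable v u := fun e => hij (hi.trans (e.trans hj.symm))
  refine ⟨?_, hac.sup_edge_of_not_reachable hvu⟩
  have hle : F ≤ F ⊔ edge v u := le_sup_left
  have hne : v ≠ u := by rintro rfl; exact hvu .rfl
  have hadj : (F ⊔ edge v u).Adj v u := Or.inr (by simp [edge_adj, hne])
  refine (connected_iff_exists_forall_reachable _).mpr ⟨i, fun w => ?_⟩
  rcases hw w with h | h
  · exact h.mono hle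
  · exact (hi.mono hle).trans (hadj.reachable.trans ((hj.symm.trans h).mono hle))

lemma IsTree.isSeparatingForest_deleteEdges {G T : SimpleGraph V} {i j v u : V} (hT : T.IsTree)
    (hle : T ≤ G) (h : T.Crosses i j v u) :
    G.IsSeparatingForest i j (T.deleteEdges {s(v, u)}) := by
  obtain ⟨hvu, hi, hj⟩ := h
  refine isSeparatingForest_iff.mpr ⟨(deleteEdges_le _).trans hle,
    hT.isAcyclic.anti (deleteEdges_le _), fun w => ?_, fun hij =>
    hT.isAcyclic.not_reachable_deleteEdges hvu (hi.symm.trans (hij.trans hj))⟩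
  obtain ⟨p⟩ := hT.connected.preconnected w v
  exact (p.reachable_deleteEdges_or u).imp (fun h => hi.trans h.symm) (fun h => hj.trans h.symm)

open Classical in
/-- Adding the edge `vu` is a bijection from separating forests with `v` on the side of `i` and
`u` on the side of `j` to spanning trees whose path from `i` to `j` crosses from `v` to `u`. -/
lemma card_isSeparatingForest_eq_card_crosses [Fintype V] {G : SimpleGraph V} {v u : V}
    (hvu : G.Adj v u) (i j : V) :
    #{F | G.IsSeparatingForest i j F ∧ F.Reachable i v ∧ F.Reachable j u}
      = #{T | (T ≤ G ∧ T.IsTree) ∧ T.Crosses i j v u} := by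
  have hnadj : ∀ {F : SimpleGraph V},
      G.IsSeparatingForest i j F ∧ F.Reachable i v ∧ F.Reachable j u → ¬ F.Adj v u :=
    fun ⟨hF, hi, hj⟩ e => hF.2.2.2 (hi.trans (e.reachable.trans hj.symm))
  refine Finset.card_bij' (fun F _ => F ⊔ edge v u) (fun T _ => T.deleteEdges {s(v, u)})
    ?_ ?_ ?_ ?_
  · intro F hF
    rw [Finset.mem_filter_univ] at hF ⊢
    refine ⟨⟨sup_le hF.1.1 ?_, hF.1.isTree_sup_edge hF.2.1 hF.2.2⟩, ?_, ?_⟩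
    · intro a b hab
      rcases (edge_adj ..).mp hab with ⟨⟨rfl, rfl⟩ | ⟨rfl, rfl⟩, -⟩
      · exact hvu
      · exact hvu.symm
    · exact Or.inr (by simp [edge_adj, hvu.ne])
    · rw [deleteEdges_sup_edge_of_not_adj (hnadj hF)]
      exact hF.2
  · intro T hT
    rw [Finset.mem_filter_univ] at hT ⊢
    exact ⟨hT.1.2.isSeparatingForest_deleteEdges hT.1.1 hT.2, hT.2.2⟩
  · intro F hF
    rw [Finset.mem_filter_univ] at hF
    exact deleteEdges_sup_edge_of_not_adj (hnadj hF)
  · intro T hT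
    rw [Finset.mem_filter_univ] at hT
    exact deleteEdges_sup_edge_of_adj hT.2.1

open Classical in
/-- The number of forests separating `i` from `j` that keep `v` on the side of `i`. Up to a
constant factor, this is the potential of the unit current flow from `i` to `j`. -/
noncomputable def forestPotential [Fintype V] (G : SimpleGraph V) (i j v : V) : ℝ :=
  #{F | G.IsSeparatingForest i j F ∧ F.Reachable i v}

open Classical in
lemma forestPotential_sub [Fintype V] (G : SimpleGraph V) (i j v u : V) :
    G.forestPotential i j v - G.forestPotential i j u
      = (#{F | G.IsSeparatingForest i j F ∧ F.Reachable i v ∧ F.Reachable j u} : ℝ)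
        - #{F | G.IsSeparatingForest i j F ∧ F.Reachable i u ∧ F.Reachable j v} := by
  simp only [forestPotential, Finset.card_filter, Nat.cast_sum, ← Finset.sum_sub_distrib]
  refine Finset.sum_congr rfl fun F _ => ?_
  by_cases hF : G.IsSeparatingForest i j F
  · obtain ⟨-, -, hw, hij⟩ := isSeparatingForest_iff.mp hF
    have hj : ∀ w, F.Reachable j w ↔ ¬ F.Reachable i w := fun w =>
      ⟨fun h1 h2 => hij (h2.trans h1.symm), fun h => (hw w).resolve_left h⟩
    simp only [hF, hj, true_and]
    by_cases hv : F.Reachable i v <;> by_cases hu : F.Reachable i u <;> simp [hv, hu]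
  · simp [hF]

open Classical in
lemma spanningTreeCount_eq_card [Fintype V] (G : SimpleGraph V) :
    spanningTreeCount G = #{T : SimpleGraph V | T ≤ G ∧ T.IsTree} := by
  rw [spanningTreeCount, Nat.card_eq_fintype_card, Fintype.card_subtype]

lemma Connected.spanningTreeCount_pos [Fintype V] {G : SimpleGraph V} (hG : G.Connected) :
    0 < spanningTreeCount G := by
  obtain ⟨T, hT⟩ := hG.exists_isTree_le
  have : Nonempty {H : SimpleGraph V // H ≤ G ∧ H.IsTree} := ⟨⟨T, hT⟩⟩
  exact Nat.card_pos

lemma forestPotential_left [Fintype V] (G : SimpleGraph V) (i j : V) :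
    G.forestPotential i j i = twoForestCount G i j := by
  classical
  rw [forestPotential, twoForestCount, Nat.card_eq_fintype_card, Fintype.card_subtype]
  simp only [Reachable.rfl, and_true, IsSeparatingForest]

lemma forestPotential_right [Fintype V] (G : SimpleGraph V) (i j : V) :
    G.forestPotential i j j = 0 := by
  classical
  rw [forestPotential, Nat.cast_eq_zero, Finset.card_eq_zero, Finset.filter_eq_empty_iff]
  exact fun F _ h => h.1.2.2.2 h.2

/-- **Kirchhoff**: the Laplacian sends the forest potential to `τ(G)` times the source-sink vector
of `i` and `j`. -/
lemma lapMatrix_mulVec_forestPotential [Fintype V] [DecidableEq V] (G : SimpleGraph V)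
    [DecidableRel G.Adj] (i j : V) :
    G.lapMatrix ℝ *ᵥ G.forestPotential i j
      = (spanningTreeCount G : ℝ) • (Pi.single i 1 - Pi.single j 1) := by
  classical
  ext v
  have hcross : ∀ u, (if G.Adj v u then G.forestPotential i j v - G.forestPotential i j u else 0)
      = ∑ T : SimpleGraph V with T ≤ G ∧ T.IsTree,
        ((if T.Crosses i j v u then (1 : ℝ) else 0) - (if T.Crosses i j u v then 1 else 0)) := by
    intro u
    split_ifs with h
    · rw [forestPotential_sub, card_isSeparatingForest_eq_card_crosses h,
        card_isSeparatingForest_eq_card_crosses h.symm, Finset.sum_sub_distrib]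
      simp only [Finset.sum_boole, Finset.filter_filter]
      congr!
    · refine (Finset.sum_eq_zero fun T hT => ?_).symm
      rw [Finset.mem_filter_univ] at hT
      have h1 : ¬ T.Crosses i j v u := fun e => h (hT.1 e.1)
      have h2 : ¬ T.Crosses i j u v := fun e => h (hT.1 e.1).symm
      simp [h1, h2]
  have hlap : (G.lapMatrix ℝ *ᵥ G.forestPotential i j) v
      = ∑ u, if G.Adj v u then G.forestPotential i j v - G.forestPotential i j u else 0 := by
    rw [lapMatrix_mulVec_apply, ← Finset.sum_filter, ← neighborFinset_eq_filter,
      Finset.sum_sub_distrib, Finset.sum_const, card_neighborFinset_eq_degree, nsmul_eq_mul]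
  rw [hlap, Finset.sum_congr rfl fun u _ => hcross u, Finset.sum_comm,
    Finset.sum_congr rfl fun T hT =>
      ((Finset.mem_filter_univ T).mp hT).2.sum_crosses_sub i j v,
    Finset.sum_const, spanningTreeCount_eq_card, nsmul_eq_mul]
  simp only [Pi.smul_apply, Pi.sub_apply, smul_eq_mul, Pi.single_apply, eq_comm (a := v)]
  congr!

lemma Connected.isUnit_lapMatrix_add_one [Fintype V] [DecidableEq V] {G : SimpleGraph V}
    [DecidableRel G.Adj] (hG : G.Connected) :
    IsUnit (G.lapMatrix ℝ + Matrix.of fun _ _ => (1 : ℝ)) := by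
  have hJ : ∀ x : V → ℝ, (Matrix.of fun _ _ : V => (1 : ℝ)) *ᵥ x = fun _ => ∑ w, x w := by
    intro x
    ext v
    simp [mulVec, dotProduct]
  rw [← Matrix.mulVec_injective_iff_isUnit, ← Matrix.coe_mulVecLin, injective_iff_map_eq_zero]
  intro x hx
  rw [Matrix.mulVecLin_apply, add_mulVec, hJ] at hx
  have hq : x ⬝ᵥ (G.lapMatrix ℝ *ᵥ x) + (∑ w, x w) ^ 2 = 0 := by
    have := congrArg (x ⬝ᵥ ·) hx
    simp only [dotProduct_add, dotProduct_zero] at this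
    rw [← this, sq]
    simp [dotProduct, Finset.sum_mul]
  have hL : 0 ≤ x ⬝ᵥ (G.lapMatrix ℝ *ᵥ x) := by
    simpa using (posSemidef_lapMatrix ℝ G).dotProduct_mulVec_nonneg x
  have hs : ∑ w, x w = 0 := by nlinarith [sq_nonneg (∑ w, x w)]
  have hL0 : G.lapMatrix ℝ *ᵥ x = 0 := by
    rw [hs] at hx
    ext v
    simpa using congrFun hx v
  rw [lapMatrix_mulVec_eq_zero_iff_forall_reachable] at hL0
  ext v
  have hc : ∑ w, x w = Fintype.card V * x v := by
    rw [Finset.sum_congr rfl fun w _ => hL0 w v (hG.preconnected w v)]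
    simp
  have : Nonempty V := ⟨v⟩
  rw [hs] at hc
  simpa using hc.symm

end SimpleGraph

/-- For a connected graph `G` with Gram matrix `K = (L + J)⁻¹`, the resistance
`r_{i,j} = K_{i,i} + K_{j,j} − 2 K_{i,j}` equals `τ(G;i,j)/τ(G)`. -/
theorem stmt_10 {V : Type*} [Fintype V] [DecidableEq V]
    (G : SimpleGraph V) [DecidableRel G.Adj] (hG : G.Connected)
    (K : Matrix V V ℝ)
    (hK : K = (G.lapMatrix ℝ + Matrix.of fun _ _ => (1 : ℝ))⁻¹)
    (i j : V) :
    K i i + K j j - 2 * K i j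
      = (twoForestCount G i j : ℝ) / (spanningTreeCount G : ℝ) := by
  classical
  set M : Matrix V V ℝ := G.lapMatrix ℝ + Matrix.of fun _ _ => (1 : ℝ) with hM
  have hdet : IsUnit M.det := (Matrix.isUnit_iff_isUnit_det M).mp hG.isUnit_lapMatrix_add_one
  have hKM : K * M = 1 := by rw [hK, Matrix.nonsing_inv_mul _ hdet]
  have hMs : Mᵀ = M := by
    rw [hM, transpose_add, (G.isSymm_lapMatrix (R := ℝ)).eq]
    rfl
  have hsymm : K j i = K i j := by
    have : Kᵀ = K := by rw [hK, transpose_nonsing_inv, hMs]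
    exact congrFun (congrFun this i) j
  have hJ : ∀ x : V → ℝ, (Matrix.of fun _ _ : V => (1 : ℝ)) *ᵥ x = (∑ w, x w) • fun _ => 1 := by
    intro x
    ext v
    simp [mulVec, dotProduct]
  have hcard : (Fintype.card V : ℝ) ≠ 0 := by
    have : Nonempty V := ⟨i⟩
    exact_mod_cast Fintype.card_ne_zero
  have hM1 : M *ᵥ (fun _ => 1) = (Fintype.card V : ℝ) • fun _ => 1 := by
    rw [hM, add_mulVec, G.lapMatrix_mulVec_const_eq_zero, hJ]
    simp
  have hK1 : (fun _ => 1 : V → ℝ) = (Fintype.card V : ℝ) • (K *ᵥ fun _ => 1) := by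
    rw [← mulVec_smul, ← hM1, mulVec_mulVec, hKM, one_mulVec]
  have hφ : G.forestPotential i j = (spanningTreeCount G : ℝ) • (K.col i - K.col j)
      + (∑ w, G.forestPotential i j w) • (K *ᵥ fun _ => 1) := by
    calc G.forestPotential i j = K *ᵥ (M *ᵥ G.forestPotential i j) := by
          rw [mulVec_mulVec, hKM, one_mulVec]
      _ = _ := by
          rw [hM, add_mulVec, G.lapMatrix_mulVec_forestPotential, hJ, mulVec_add, mulVec_smul,
            mulVec_smul, mulVec_sub, mulVec_single_one, mulVec_single_one]
  have hconst : (K *ᵥ fun _ => 1) i = (K *ᵥ fun _ => 1) j := by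
    have h1 := congrFun hK1 i
    have h2 := congrFun hK1 j
    simp only [Pi.smul_apply, smul_eq_mul] at h1 h2
    exact mul_left_cancel₀ hcard (h1.symm.trans h2)
  have hi := congrFun hφ i
  have hj := congrFun hφ j
  rw [G.forestPotential_left] at hi
  rw [G.forestPotential_right] at hj
  simp only [Pi.add_apply, Pi.smul_apply, Pi.sub_apply, smul_eq_mul, col_apply] at hi hj
  have hτ : (spanningTreeCount G : ℝ) ≠ 0 := by exact_mod_cast hG.spanningTreeCount_pos.ne'
  rw [eq_div_iff hτ]
  rw [hconst] at hi
  rw [hsymm] at hj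
  linear_combination hj - hi
end

section
/- Let G be a connected simple graph on n vertices, let i and j be two non-adjacent vertices of G, and let G' be the graph obtained from G by adding the edge {i,j}. Let K = (L_G + J)⁻¹ and K' = (L_{G'} + J)⁻¹ be the Gram matrices of G and G'. Then K_{l,l} ≥ K'_{l,l} for every vertex l. -/
namespace Matrix

variable {n : Type*} [Fintype n] [DecidableEq n]

theorem PosDef.dotProduct_inv_mulVec_le {M N : Matrix n n ℝ} (hM : M.PosDef)
    (hMN : (N - M).PosSemidef) (v : n → ℝ) :
    v ⬝ᵥ (N⁻¹ *ᵥ v) ≤ v ⬝ᵥ (M⁻¹ *ᵥ v) := by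
  have hN : N.PosDef := by simpa using hM.add_posSemidef hMN
  set x := M⁻¹ *ᵥ v with hx
  set y := N⁻¹ *ᵥ v with hy
  have hMx : M *ᵥ x = v := by
    rw [hx, mulVec_mulVec, mul_nonsing_inv _ ((isUnit_iff_isUnit_det M).mp hM.isUnit), one_mulVec]
  have hNy : N *ᵥ y = v := by
    rw [hy, mulVec_mulVec, mul_nonsing_inv _ ((isUnit_iff_isUnit_det N).mp hN.isUnit), one_mulVec]
  have hMt : Mᵀ = M := by simpa using hM.isHermitian.eq
  have hxy : x ⬝ᵥ (M *ᵥ y) = v ⬝ᵥ y := by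
    rw [dotProduct_mulVec, ← mulVec_transpose, hMt, hMx]
  have h₁ := hMN.dotProduct_mulVec_nonneg y
  have h₂ := hM.posSemidef.dotProduct_mulVec_nonneg (x - y)
  simp only [star_trivial, sub_mulVec, mulVec_sub, dotProduct_sub, sub_dotProduct,
    hMx, hNy, hxy, dotProduct_comm _ v] at h₁ h₂
  linarith

end Matrix

namespace SimpleGraph

variable {V : Type*} [Fintype V] [DecidableEq V]

theorem Connected.posDef_lapMatrix_add_one {G : SimpleGraph V} [DecidableRel G.Adj]
    (hG : G.Connected) : (G.lapMatrix ℝ + Matrix.of fun _ _ => (1 : ℝ)).PosDef := by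
  have hJ (x : V → ℝ) : x ⬝ᵥ ((Matrix.of fun _ _ : V => (1 : ℝ)).mulVec x) = (∑ u, x u) ^ 2 := by
    simp [dotProduct, Matrix.mulVec, ← Finset.sum_mul, sq]
  refine .of_dotProduct_mulVec_pos ?_ fun x hx => ?_
  · exact (G.isHermitian_lapMatrix ℝ).add (by ext; simp)
  · rw [star_trivial, Matrix.add_mulVec, dotProduct_add, hJ]
    have hL : 0 ≤ x ⬝ᵥ ((G.lapMatrix ℝ).mulVec x) := by
      simpa using (posSemidef_lapMatrix ℝ G).dotProduct_mulVec_nonneg x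
    refine lt_of_le_of_ne (by positivity) fun h => hx ?_
    have hL₀ : x ⬝ᵥ ((G.lapMatrix ℝ).mulVec x) = 0 := by nlinarith [sq_nonneg (∑ u, x u)]
    have hs : ∑ u, x u = 0 := by
      rw [hL₀, zero_add] at h
      exact pow_eq_zero_iff two_ne_zero |>.mp h.symm
    rw [← Matrix.toLinearMap₂'_apply',
      lapMatrix_toLinearMap₂'_apply'_eq_zero_iff_forall_reachable] at hL₀
    ext u
    have : Nonempty V := ⟨u⟩
    simpa [fun w => hL₀ w u (hG.preconnected w u)] using hs

theorem posSemidef_lapMatrix_sub_of_le {G H : SimpleGraph V} [DecidableRel G.Adj]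
    [DecidableRel H.Adj] (h : G ≤ H) : (H.lapMatrix ℝ - G.lapMatrix ℝ).PosSemidef := by
  refine .of_dotProduct_mulVec_nonneg
    ((H.isHermitian_lapMatrix ℝ).sub (G.isHermitian_lapMatrix ℝ)) fun x => ?_
  rw [star_trivial, Matrix.sub_mulVec, dotProduct_sub, ← Matrix.toLinearMap₂'_apply',
    ← Matrix.toLinearMap₂'_apply', lapMatrix_toLinearMap₂', lapMatrix_toLinearMap₂', sub_nonneg]
  gcongr with u _ w _
  split_ifs with hGuw hHuw hHuw
  · rfl
  · exact absurd (h hGuw) hHuw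
  · positivity
  · rfl

end SimpleGraph

/-- Adding an edge `{i,j}` between non-adjacent vertices of a connected graph
`G` does not increase any diagonal entry of the Gram matrix `K = (L + J)⁻¹`. -/
theorem stmt_15 {V : Type*} [Fintype V] [DecidableEq V]
    (G G' : SimpleGraph V) [DecidableRel G.Adj] [DecidableRel G'.Adj]
    (hG : G.Connected) (i j : V) (hij : i ≠ j) (hnadj : ¬ G.Adj i j)
    (hG' : ∀ x y : V, G'.Adj x y ↔ G.Adj x y ∨ (x = i ∧ y = j) ∨ (x = j ∧ y = i))
    (K K' : Matrix V V ℝ)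
    (hK : K = (G.lapMatrix ℝ + Matrix.of fun _ _ => (1 : ℝ))⁻¹)
    (hK' : K' = (G'.lapMatrix ℝ + Matrix.of fun _ _ => (1 : ℝ))⁻¹)
    (l : V) :
    K' l l ≤ K l l := by
  subst hK hK'
  have hle : G ≤ G' := fun x y h => (hG' x y).mpr (.inl h)
  have hsub : ((G'.lapMatrix ℝ + Matrix.of fun _ _ => (1 : ℝ)) -
      (G.lapMatrix ℝ + Matrix.of fun _ _ => (1 : ℝ))).PosSemidef := by
    rw [add_sub_add_right_eq_sub]
    exact SimpleGraph.posSemidef_lapMatrix_sub_of_le hle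
  simpa using hG.posDef_lapMatrix_add_one.dotProduct_inv_mulVec_le hsub (Pi.single l 1)
end

section
/- Let T be a tree on n vertices with Gram matrix K = (L + J)⁻¹. If i, j, j' are vertices with i ≠ j, j' adjacent to j, and d(i,j') = d(i,j) − 1 (so j' is the neighbor of j on the unique path from i to j), then K_{i,j'} > K_{i,j}. Consequently the entries K_{i,·} strictly decrease along any path starting at i. -/
open Finset Matrix in
/-- Summing the Laplacian of `f` over a set `C` leaves only the flow through the edges
leaving `C`. -/
theorem SimpleGraph.sum_lapMatrix_mulVec {V : Type*} [Fintype V] [DecidableEq V]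
    (G : SimpleGraph V) [DecidableRel G.Adj] (f : V → ℝ) (C : Finset V) :
    ∑ v ∈ C, (G.lapMatrix ℝ *ᵥ f) v =
      ∑ v ∈ C, ∑ w ∈ Cᶜ, if G.Adj v w then f v - f w else 0 := by
  have hrow (v : V) : (G.lapMatrix ℝ *ᵥ f) v = ∑ w, if G.Adj v w then f v - f w else 0 := by
    rw [G.lapMatrix_mulVec_apply, ← sum_filter, ← G.neighborFinset_eq_filter, sum_sub_distrib]
    simp
  have hanti : ∑ v ∈ C, ∑ w ∈ C, (if G.Adj v w then f v - f w else 0) = 0 := by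
    have hswap : ∑ v ∈ C, ∑ w ∈ C, (if G.Adj v w then f v - f w else 0) =
        -∑ v ∈ C, ∑ w ∈ C, (if G.Adj v w then f v - f w else 0) := by
      conv_lhs => rw [sum_comm]
      simp_rw [← sum_neg_distrib]
      refine sum_congr rfl fun v _ => sum_congr rfl fun w _ => ?_
      simp only [G.adj_comm w v]
      split_ifs <;> ring
    linarith
  simp_rw [hrow, ← sum_add_sum_compl C (fun w => ite (G.Adj _ w) _ _)]
  rw [sum_add_distrib, hanti, zero_add]

open Finset Matrix in
theorem SimpleGraph.sum_univ_lapMatrix_mulVec {V : Type*} [Fintype V] [DecidableEq V]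
    (G : SimpleGraph V) [DecidableRel G.Adj] (f : V → ℝ) :
    ∑ v, (G.lapMatrix ℝ *ᵥ f) v = 0 := by
  simp [G.sum_lapMatrix_mulVec f univ]

open Finset Matrix in
theorem SimpleGraph.lapMatrix_add_ones_mulVec {V : Type*} [Fintype V] [DecidableEq V]
    (G : SimpleGraph V) [DecidableRel G.Adj] (f : V → ℝ) (v : V) :
    ((G.lapMatrix ℝ + Matrix.of fun _ _ => (1 : ℝ)) *ᵥ f) v =
      (G.lapMatrix ℝ *ᵥ f) v + ∑ w, f w := by
  rw [add_mulVec, Pi.add_apply]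
  congr 1
  simp [mulVec, dotProduct]

open Finset Matrix in
theorem SimpleGraph.sum_lapMatrix_add_ones_mulVec {V : Type*} [Fintype V] [DecidableEq V]
    (G : SimpleGraph V) [DecidableRel G.Adj] (f : V → ℝ) :
    ∑ v, ((G.lapMatrix ℝ + Matrix.of fun _ _ => (1 : ℝ)) *ᵥ f) v =
      Fintype.card V * ∑ w, f w := by
  simp_rw [G.lapMatrix_add_ones_mulVec, sum_add_distrib, G.sum_univ_lapMatrix_mulVec]
  simp

open Finset Matrix in
theorem SimpleGraph.Connected.det_lapMatrix_add_ones_ne_zero {V : Type*} [Fintype V]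
    [DecidableEq V] {G : SimpleGraph V} [DecidableRel G.Adj] (hG : G.Connected) :
    (G.lapMatrix ℝ + Matrix.of fun _ _ => (1 : ℝ)).det ≠ 0 := by
  have := hG.nonempty
  have hn : (Fintype.card V : ℝ) ≠ 0 := by simp
  intro hdet
  obtain ⟨x, hx, hMx⟩ := exists_mulVec_eq_zero_iff.mpr hdet
  have hsum : ∑ w, x w = 0 := by
    have := G.sum_lapMatrix_add_ones_mulVec x
    simpa [hMx] using this
  have hLx : G.lapMatrix ℝ *ᵥ x = 0 := by
    ext v
    simpa [hMx, hsum] using (G.lapMatrix_add_ones_mulVec x v).symm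
  rw [G.lapMatrix_mulVec_eq_zero_iff_forall_reachable] at hLx
  refine hx (funext fun v => ?_)
  have hconst : ∑ w, x w = Fintype.card V * x v := by
    simp [sum_congr rfl fun w _ => hLx w v (hG.preconnected w v)]
  simpa [hsum] using hconst

/-- A vertex closer to `j'` than to `j` stays connected to `j'` when the edge `jj'` is deleted. -/
theorem SimpleGraph.Connected.reachable_deleteEdges_of_dist_lt {V : Type*} {G : SimpleGraph V}
    (hG : G.Connected) {i j j' : V} (h : G.dist i j' < G.dist i j) :
    (G.deleteEdges {s(j, j')}).Reachable i j' := by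
  classical
  obtain ⟨p, hp⟩ := hG.exists_walk_length_eq_dist i j'
  refine ⟨p.toDeleteEdge s(j, j') fun he => ?_⟩
  have hj := p.fst_mem_support_of_mem_edges he
  have h₁ := SimpleGraph.dist_le (p.takeUntil j hj)
  have h₂ := p.length_takeUntil_le_length hj
  omega

open Finset Matrix in
/-- For a tree `T` with Gram matrix `K = (L + J)⁻¹`: if `i ≠ j`, `j'` is
adjacent to `j` and `d(i,j') = d(i,j) − 1` (so `j'` is the neighbour of `j` on
the unique path from `i` to `j`), then `K_{i,j'} > K_{i,j}`; hence the entries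
`K_{i,·}` strictly decrease along any path starting at `i`. -/
theorem stmt_16 {V : Type*} [Fintype V] [DecidableEq V]
    (T : SimpleGraph V) [DecidableRel T.Adj] (hT : T.IsTree)
    (K : Matrix V V ℝ)
    (hK : K = (T.lapMatrix ℝ + Matrix.of fun _ _ => (1 : ℝ))⁻¹)
    (i j j' : V) (hij : i ≠ j) (hadj : T.Adj j j')
    (hd : T.dist i j' = T.dist i j - 1) :
    K i j < K i j' := by
  classical
  have hconn := hT.connected
  have : Nonempty V := ⟨i⟩
  have hn : (0 : ℝ) < Fintype.card V := by exact_mod_cast Fintype.card_pos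
  set M : Matrix V V ℝ := T.lapMatrix ℝ + Matrix.of fun _ _ => (1 : ℝ) with hM
  have hMsymm : Mᵀ = M := by
    rw [hM, transpose_add, (T.isSymm_lapMatrix (R := ℝ)).eq]
    rfl
  have hMf : M *ᵥ K i = Pi.single i 1 := by
    rw [← vecMul_transpose, hMsymm]
    have hKM : K * M = 1 := by
      rw [hK]
      exact nonsing_inv_mul M hconn.det_lapMatrix_add_ones_ne_zero.isUnit
    ext v
    rw [← mul_apply_eq_vecMul, hKM, one_apply, Pi.single_apply]
    simp only [eq_comm]
  have hsum : Fintype.card V * ∑ w, K i w = 1 := by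
    rw [← T.sum_lapMatrix_add_ones_mulVec, ← hM, hMf]
    simp
  have hpos : 0 < ∑ w, K i w := by
    by_contra! hle
    nlinarith
  have hlt : T.dist i j' < T.dist i j := by
    have := hconn.pos_dist_of_ne hij
    omega
  have hbridge : ¬ (T.deleteEdges {s(j, j')}).Reachable j j' :=
    SimpleGraph.isBridge_iff.mp
      (SimpleGraph.isAcyclic_iff_forall_adj_isBridge.mp hT.isAcyclic hadj)
  let C : Finset V := {v | (T.deleteEdges {s(j, j')}).Reachable j v}
  have hmem (v : V) : v ∈ C ↔ (T.deleteEdges {s(j, j')}).Reachable j v := by simp [C]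
  have hjC : j ∈ C := (hmem j).mpr .rfl
  have hj'C : j' ∉ C := fun h => hbridge ((hmem j').mp h)
  have hiC : i ∉ C := fun h =>
    hbridge (((hmem i).mp h).trans (hconn.reachable_deleteEdges_of_dist_lt hlt))
  have hcross {v w : V} (hv : v ∈ C) (hw : w ∉ C) (hvw : T.Adj v w) : v = j ∧ w = j' := by
    have he : s(v, w) = s(j, j') := by
      by_contra hne
      refine hw ((hmem w).mpr (((hmem v).mp hv).trans (SimpleGraph.Adj.reachable ?_)))
      simpa [SimpleGraph.deleteEdges_adj, hvw] using hne
    rcases Sym2.eq_iff.mp he with h | ⟨rfl, rfl⟩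
    · exact h
    · exact absurd hv hj'C
  have hflow : ∑ v ∈ C, (T.lapMatrix ℝ *ᵥ K i) v = K i j - K i j' := by
    rw [T.sum_lapMatrix_mulVec, sum_eq_single_of_mem j hjC, sum_eq_single_of_mem j' (by simpa)]
    · simp [hadj]
    · intro w hw hne
      exact if_neg fun h => hne (hcross hjC (by simpa using hw) h).2
    · intro v hv hne
      refine sum_eq_zero fun w hw => if_neg fun h => hne (hcross hv (by simpa using hw) h).1
  have hneg : ∑ v ∈ C, (T.lapMatrix ℝ *ᵥ K i) v < 0 := by
    refine sum_neg (fun v hv => ?_) ⟨j, hjC⟩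
    have hv_eq := T.lapMatrix_add_ones_mulVec (K i) v
    rw [← hM, hMf, Pi.single_eq_of_ne (ne_of_mem_of_not_mem hv hiC)] at hv_eq
    linarith
  linarith
end

section
/- Let G be a connected simple graph on n vertices with Gram matrix K = (L + J)⁻¹, and let K̄(G) = max_{i∈V} K_{i,i} denote the maximum diagonal entry. Then 1/n ≤ K̄(G) ≤ K̄(P_n), where P_n is the path graph on n vertices. The left equality holds if and only if G is the complete graph, and the right equality holds if and only if G is isomorphic to the path P_n. -/
/-- The Gram matrix `K(G) = (L + J)⁻¹` of a graph `G`, where `L` is the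
Laplacian matrix and `J` the all-ones matrix. -/
noncomputable def gramMatrix {V : Type*} [Fintype V] [DecidableEq V]
    (G : SimpleGraph V) : Matrix V V ℝ :=
  letI := Classical.decRel G.Adj
  (G.lapMatrix ℝ + Matrix.of fun _ _ => (1 : ℝ))⁻¹

/-- `K̄(G)`: the maximum diagonal entry of the Gram matrix of `G`. -/
noncomputable def maxDiag {V : Type*} [Fintype V] [DecidableEq V]
    (G : SimpleGraph V) : ℝ :=
  ⨆ i : V, gramMatrix G i i

open Finset Matrix

namespace SimpleGraph

section GramForm

variable {V W : Type*} [Fintype V] [Fintype W]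

/-- The quadratic form `xᵀ (L + J) x` of a graph. -/
noncomputable def gramForm (G : SimpleGraph V) [DecidableRel G.Adj] (x : V → ℝ) : ℝ :=
  (∑ i, ∑ j, if G.Adj i j then (x i - x j) ^ 2 else 0) / 2 + (∑ i, x i) ^ 2

theorem gramForm_nonneg (G : SimpleGraph V) [DecidableRel G.Adj] (x : V → ℝ) :
    0 ≤ G.gramForm x := by
  unfold gramForm
  positivity

theorem Iso.gramForm_comp {G : SimpleGraph V} {H : SimpleGraph W} [DecidableRel G.Adj]
    [DecidableRel H.Adj] (φ : G ≃g H) (x : W → ℝ) :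
    G.gramForm (fun i => x (φ i)) = H.gramForm x := by
  unfold gramForm
  rw [← φ.toEquiv.sum_comp x, ← φ.toEquiv.sum_comp]
  congr 2
  refine sum_congr rfl fun i _ => ?_
  rw [← φ.toEquiv.sum_comp]
  refine sum_congr rfl fun j _ => ?_
  exact if_congr φ.map_adj_iff.symm rfl rfl

end GramForm

section GramMatrix

variable {V : Type*} [Fintype V] [DecidableEq V]

theorem gramMatrix_eq (G : SimpleGraph V) [DecidableRel G.Adj] :
    gramMatrix G = (G.lapMatrix ℝ + Matrix.of fun _ _ => (1 : ℝ))⁻¹ := by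
  unfold gramMatrix
  congr!

theorem dotProduct_lapMatrix_add_ones_mulVec_s17 (G : SimpleGraph V) [DecidableRel G.Adj]
    (x : V → ℝ) :
    x ⬝ᵥ ((G.lapMatrix ℝ + Matrix.of fun _ _ => (1 : ℝ)) *ᵥ x) = G.gramForm x := by
  rw [add_mulVec, dotProduct_add, ← toLinearMap₂'_apply', lapMatrix_toLinearMap₂', gramForm]
  congr 1
  simp [dotProduct, mulVec, ← sum_mul, sq]

theorem Connected.eq_zero_of_gramForm_eq_zero {G : SimpleGraph V} [DecidableRel G.Adj]
    (hG : G.Connected) {x : V → ℝ} (hx : G.gramForm x = 0) : x = 0 := by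
  unfold gramForm at hx
  have h1 : 0 ≤ (∑ i, ∑ j, if G.Adj i j then (x i - x j) ^ 2 else 0) / 2 := by positivity
  obtain ⟨h2, h3⟩ := (add_eq_zero_iff_of_nonneg h1 (sq_nonneg _)).1 hx
  rw [← lapMatrix_toLinearMap₂', lapMatrix_toLinearMap₂'_apply'_eq_zero_iff_forall_reachable] at h2
  ext i
  have h4 : ∑ j, x j = Fintype.card V * x i := by
    rw [sum_congr rfl fun j _ => h2 j i (hG.preconnected j i)]
    simp
  have : Nonempty V := ⟨i⟩
  rw [pow_eq_zero_iff two_ne_zero, h4] at h3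
  simpa using h3

theorem Connected.isUnit_det_lapMatrix_add_ones {G : SimpleGraph V} [DecidableRel G.Adj]
    (hG : G.Connected) : IsUnit (G.lapMatrix ℝ + Matrix.of fun _ _ => (1 : ℝ)).det := by
  rw [isUnit_iff_ne_zero]
  intro h
  obtain ⟨v, hv, h0⟩ := Matrix.exists_mulVec_eq_zero_iff.2 h
  apply hv
  apply hG.eq_zero_of_gramForm_eq_zero
  rw [← dotProduct_lapMatrix_add_ones_mulVec_s17, h0, dotProduct_zero]

theorem Connected.lapMatrix_add_ones_mulVec_gramMatrix_col {G : SimpleGraph V}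
    [DecidableRel G.Adj] (hG : G.Connected) (i : V) :
    (G.lapMatrix ℝ + Matrix.of fun _ _ => (1 : ℝ)) *ᵥ (gramMatrix G).col i = Pi.single i 1 := by
  rw [← mulVec_single_one, mulVec_mulVec, gramMatrix_eq,
    Matrix.mul_nonsing_inv _ hG.isUnit_det_lapMatrix_add_ones, one_mulVec]

theorem Connected.gramMatrix_apply_self {G : SimpleGraph V} [DecidableRel G.Adj]
    (hG : G.Connected) (i : V) :
    gramMatrix G i i =
      2 * (gramMatrix G).col i i - G.gramForm ((gramMatrix G).col i) := by
  rw [← dotProduct_lapMatrix_add_ones_mulVec_s17, hG.lapMatrix_add_ones_mulVec_gramMatrix_col,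
    dotProduct_single, col_apply]
  ring

theorem Connected.two_mul_sub_gramForm_le {G : SimpleGraph V} [DecidableRel G.Adj]
    (hG : G.Connected) (i : V) (z : V → ℝ) :
    2 * z i - G.gramForm z ≤ gramMatrix G i i := by
  have h := G.gramForm_nonneg (z - (gramMatrix G).col i)
  have hs : (G.lapMatrix ℝ + Matrix.of fun _ _ => (1 : ℝ)).IsSymm :=
    (G.isSymm_lapMatrix ℝ).add (by ext; simp)
  have hx := hG.lapMatrix_add_ones_mulVec_gramMatrix_col i
  have hc : (gramMatrix G).col i ⬝ᵥ ((G.lapMatrix ℝ + Matrix.of fun _ _ => (1 : ℝ)) *ᵥ z)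
      = z i := by
    rw [dotProduct_mulVec, ← mulVec_transpose, hs.eq, hx, single_one_dotProduct]
  rw [← dotProduct_lapMatrix_add_ones_mulVec_s17] at h ⊢
  rw [mulVec_sub, hx, sub_dotProduct, dotProduct_sub, dotProduct_sub, dotProduct_single,
    dotProduct_single, col_apply, hc] at h
  linarith

theorem gramMatrix_top : gramMatrix (⊤ : SimpleGraph V) = (Fintype.card V : ℝ)⁻¹ • 1 := by
  rw [gramMatrix_eq]
  refine inv_eq_right_inv ?_
  ext i j
  have : Nonempty V := ⟨i⟩
  have hpos : 1 ≤ Fintype.card V := Fintype.card_pos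
  have h0 : (Fintype.card V : ℝ) ≠ 0 := by simp
  rw [Matrix.mul_smul, mul_one]
  by_cases hij : i = j
  · subst hij
    simp [lapMatrix, degMatrix, Nat.cast_sub hpos, h0]
  · simp [lapMatrix, degMatrix, hij]

theorem Connected.two_div_sub_le_gramMatrix_apply_self {G : SimpleGraph V} [DecidableRel G.Adj]
    (hG : G.Connected) (i : V) :
    2 / (Fintype.card V : ℝ) - (G.degree i + 1) / (Fintype.card V : ℝ) ^ 2 ≤
      gramMatrix G i i := by
  have h := hG.two_mul_sub_gramForm_le i (Pi.single i (Fintype.card V : ℝ)⁻¹)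
  rw [← dotProduct_lapMatrix_add_ones_mulVec_s17, single_dotProduct, mulVec_single] at h
  convert h using 1
  simp [lapMatrix, degMatrix]
  ring

theorem gramMatrix_apply_self_le_maxDiag (G : SimpleGraph V) (i : V) :
    gramMatrix G i i ≤ maxDiag G :=
  le_ciSup (f := fun i => gramMatrix G i i) (Set.finite_range _).bddAbove i

theorem exists_gramMatrix_apply_self_eq_maxDiag [Nonempty V] (G : SimpleGraph V) :
    ∃ i, gramMatrix G i i = maxDiag G :=
  exists_eq_ciSup_of_finite (f := fun i => gramMatrix G i i)

theorem Connected.one_div_card_add_le_maxDiag {G : SimpleGraph V} [DecidableRel G.Adj]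
    (hG : G.Connected) (i : V) :
    1 / (Fintype.card V : ℝ) +
      (Fintype.card V - (G.degree i + 1)) / (Fintype.card V : ℝ) ^ 2 ≤ maxDiag G := by
  refine le_of_eq_of_le ?_ ((hG.two_div_sub_le_gramMatrix_apply_self i).trans
    (G.gramMatrix_apply_self_le_maxDiag i))
  have : Nonempty V := ⟨i⟩
  have h0 : (Fintype.card V : ℝ) ≠ 0 := by simp
  field_simp
  ring

theorem Connected.one_div_card_le_maxDiag {G : SimpleGraph V} (hG : G.Connected) :
    1 / (Fintype.card V : ℝ) ≤ maxDiag G := by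
  classical
  obtain ⟨i⟩ := hG.nonempty
  refine le_trans (le_add_of_nonneg_right (div_nonneg ?_ (sq_nonneg _)))
    (hG.one_div_card_add_le_maxDiag i)
  exact sub_nonneg.2 (by exact_mod_cast G.degree_lt_card_verts i)

theorem Connected.maxDiag_eq_one_div_card_iff {G : SimpleGraph V} (hG : G.Connected) :
    maxDiag G = 1 / (Fintype.card V : ℝ) ↔ G = ⊤ := by
  classical
  have := hG.nonempty
  constructor
  · intro h
    have hU (i : V) : G.IsUniversal i := by
      have h1 := hG.one_div_card_add_le_maxDiag i
      have h2 : (0 : ℝ) < (Fintype.card V : ℝ) ^ 2 := by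
        have : (Fintype.card V : ℝ) ≠ 0 := by simp
        positivity
      rw [h, add_le_iff_nonpos_right, div_le_iff₀ h2, zero_mul, sub_nonpos] at h1
      have h3 : Fintype.card V ≤ G.degree i + 1 := by exact_mod_cast h1
      have h4 := G.degree_lt_card_verts i
      exact (G.degree_eq_card_sub_one i).1 (by omega)
    ext i j
    rw [top_adj]
    exact ⟨fun h => h.ne, fun h => hU i h⟩
  · rintro rfl
    obtain ⟨i, hi⟩ := exists_gramMatrix_apply_self_eq_maxDiag (⊤ : SimpleGraph V)
    rw [← hi, gramMatrix_top]
    simp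

end GramMatrix

theorem sum_range_eq_mul_sub_sum_gaps (Y : ℕ → ℝ) (m : ℕ) :
    ∑ k ∈ range (m + 1), Y k =
      (m + 1) * Y 0 - ∑ k ∈ range m, ((m : ℝ) - k) * (Y k - Y (k + 1)) := by
  induction m with
  | zero => simp
  | succ m ih =>
    have h : Y (m + 1) = Y 0 - ∑ k ∈ range (m + 1), (Y k - Y (k + 1)) := by
      rw [sum_range_sub']
      ring
    have h2 : ∑ k ∈ range (m + 1), (((m + 1 : ℕ) : ℝ) - k) * (Y k - Y (k + 1)) =
        ∑ k ∈ range m, ((m : ℝ) - k) * (Y k - Y (k + 1)) +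
          ∑ k ∈ range (m + 1), (Y k - Y (k + 1)) := by
      rw [← add_zero (∑ k ∈ range m, _), ← zero_mul (Y m - Y (m + 1)), ← sub_self (m : ℝ),
        ← sum_range_succ (fun k : ℕ => ((m : ℝ) - k) * (Y k - Y (k + 1))), ← sum_add_distrib]
      refine sum_congr rfl fun k _ => ?_
      push_cast
      ring
    rw [sum_range_succ, ih, h, h2]
    push_cast
    ring

/-- The value of `K̄(P_{m+1})`. -/
noncomputable def pathMaxDiag (m : ℕ) : ℝ :=
  1 / ((m : ℝ) + 1) ^ 2 + ∑ k ∈ range m, (((m : ℝ) - k) / (m + 1)) ^ 2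

theorem two_mul_sub_sum_gaps_sq (Y : ℕ → ℝ) (m : ℕ) :
    2 * Y 0 - (∑ k ∈ range m, (Y k - Y (k + 1)) ^ 2 + (∑ k ∈ range (m + 1), Y k) ^ 2) =
      pathMaxDiag m - (∑ k ∈ range (m + 1), Y k - 1 / (m + 1)) ^ 2 -
        ∑ k ∈ range m, (Y k - Y (k + 1) - ((m : ℝ) - k) / (m + 1)) ^ 2 := by
  have h := sum_range_eq_mul_sub_sum_gaps Y m
  set s := ∑ k ∈ range (m + 1), Y k
  have h0 : (m : ℝ) + 1 ≠ 0 := by positivity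
  have h1 : Y 0 = (s + ∑ k ∈ range m, ((m : ℝ) - k) * (Y k - Y (k + 1))) / (m + 1) := by
    field_simp
    linarith
  have h2 : ∑ k ∈ range m, (Y k - Y (k + 1) - ((m : ℝ) - k) / (m + 1)) ^ 2 =
      ∑ k ∈ range m, (Y k - Y (k + 1)) ^ 2 -
      2 * ((∑ k ∈ range m, ((m : ℝ) - k) * (Y k - Y (k + 1))) / (m + 1)) +
      ∑ k ∈ range m, (((m : ℝ) - k) / (m + 1)) ^ 2 := by
    rw [sum_div, mul_sum, ← sum_sub_distrib, ← sum_add_distrib]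
    refine sum_congr rfl fun k _ => ?_
    field_simp
    ring
  rw [h2, h1, pathMaxDiag]
  field_simp
  ring

theorem sum_Ico_sq_le_sq_sum {g : ℕ → ℝ} (hg : ∀ k, 0 ≤ g k) (a b : ℕ) :
    ∑ k ∈ Ico a b, g k ^ 2 ≤ (∑ k ∈ Ico a b, g k) ^ 2 := by
  rw [sq (∑ k ∈ Ico a b, g k), sum_mul]
  refine sum_le_sum fun k hk => ?_
  rw [sq]
  exact mul_le_mul_of_nonneg_left (single_le_sum (fun k _ => hg k) hk) (hg k)

theorem eq_succ_of_sum_Ico_sq_eq {g : ℕ → ℝ} (hg : ∀ k, 0 ≤ g k) {a b : ℕ} (hab : a < b)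
    (hpos : ∀ k ∈ Ico a b, 0 < g k)
    (h : ∑ k ∈ Ico a b, g k ^ 2 = (∑ k ∈ Ico a b, g k) ^ 2) : b = a + 1 := by
  by_contra hne
  have hlt : a + 1 < b := by omega
  refine h.not_lt ?_
  rw [sq (∑ k ∈ Ico a b, g k), sum_mul]
  refine sum_lt_sum (fun k hk => ?_) ⟨a, by simp [hab], ?_⟩
  · rw [sq]
    exact mul_le_mul_of_nonneg_left (single_le_sum (fun k _ => hg k) hk) (hg k)
  · rw [sq]
    refine mul_lt_mul_of_pos_left ?_ (hpos a (by simp [hab]))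
    exact single_lt_sum (i := a) (j := a + 1) (by omega) (by simp [hab]) (by simp [hlt])
      (hpos _ (by simp [hlt])) fun k _ _ => hg k

theorem Connected.exists_adj_across {m : ℕ} {H : SimpleGraph (Fin (m + 1))} (hH : H.Connected)
    {k : ℕ} (hk : k < m) : ∃ i j, H.Adj i j ∧ (i : ℕ) ≤ k ∧ k < (j : ℕ) := by
  obtain ⟨p⟩ := hH.preconnected 0 (Fin.last m)
  obtain ⟨d, -, h1, h2⟩ := p.exists_boundary_dart {i | (i : ℕ) ≤ k} (by simp) (by simpa)
  exact ⟨d.fst, d.snd, d.adj, h1, by simpa using h2⟩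

theorem sum_Ico_gaps (Y : ℕ → ℝ) {a b : ℕ} (hab : a ≤ b) :
    ∑ k ∈ Ico a b, (Y k - Y (k + 1)) = Y a - Y b := by
  rw [← neg_sub (Y b), ← sum_Ico_sub Y hab, ← sum_neg_distrib]
  simp

section SortedEnergy

variable {m : ℕ} (H : SimpleGraph (Fin (m + 1))) [DecidableRel H.Adj] (Y : ℕ → ℝ)

/-- The pairs of adjacent vertices of a graph on `Fin (m + 1)`, oriented upwards. -/
def upEdges : Finset (Fin (m + 1) × Fin (m + 1)) :=
  univ.filter fun p => H.Adj p.1 p.2 ∧ p.1 < p.2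

theorem sum_adj_div_two_eq_sum_upEdges :
    (∑ i, ∑ j, if H.Adj i j then (Y i - Y j) ^ 2 else 0) / 2 =
      ∑ p ∈ H.upEdges, (Y p.1 - Y p.2) ^ 2 := by
  have h1 : ∑ p ∈ H.upEdges, (Y p.1 - Y p.2) ^ 2 =
      ∑ i, ∑ j, if H.Adj i j ∧ i < j then (Y i - Y j) ^ 2 else 0 := by
    rw [upEdges, sum_filter, Fintype.sum_prod_type]
  have h2 : ∑ p ∈ H.upEdges, (Y p.1 - Y p.2) ^ 2 =
      ∑ i, ∑ j, if H.Adj i j ∧ j < i then (Y i - Y j) ^ 2 else 0 := by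
    rw [h1, sum_comm]
    refine sum_congr rfl fun i _ => sum_congr rfl fun j _ => ?_
    simp only [H.adj_comm j i, sub_sq_comm (Y j)]
  rw [div_eq_iff two_ne_zero, mul_two]
  nth_rewrite 1 [h1]
  rw [h2, ← sum_add_distrib]
  refine sum_congr rfl fun i _ => ?_
  rw [← sum_add_distrib]
  refine sum_congr rfl fun j _ => ?_
  rcases lt_trichotomy i j with h | rfl | h
  · simp [h, h.not_gt]
  · simp
  · simp [h, h.not_gt]

variable {H Y}

theorem Connected.sum_gaps_sq_le_sum_upEdges_sum_Ico (hH : H.Connected) :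
    ∑ k ∈ range m, (Y k - Y (k + 1)) ^ 2 ≤
      ∑ p ∈ H.upEdges, ∑ k ∈ Ico (p.1 : ℕ) p.2, (Y k - Y (k + 1)) ^ 2 := by
  have h : ∑ p ∈ H.upEdges, ∑ k ∈ Ico (p.1 : ℕ) p.2, (Y k - Y (k + 1)) ^ 2 =
      ∑ k ∈ range m, ∑ p ∈ H.upEdges with k ∈ Ico (p.1 : ℕ) p.2, (Y k - Y (k + 1)) ^ 2 := by
    refine sum_comm' fun p k => ?_
    simp only [mem_filter, mem_range, mem_Ico]
    have := p.2.isLt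
    exact ⟨fun h => ⟨h, by omega⟩, fun h => h.1⟩
  rw [h]
  refine sum_le_sum fun k hk => ?_
  obtain ⟨i, j, hij, hi, hj⟩ := hH.exists_adj_across (mem_range.1 hk)
  refine single_le_sum (f := fun _ => (Y k - Y (k + 1)) ^ 2) (fun _ _ => sq_nonneg _)
    (a := (i, j)) ?_
  simp only [upEdges, mem_filter, mem_univ, true_and, mem_Ico]
  exact ⟨⟨hij, Fin.lt_def.2 (by omega)⟩, hi, hj⟩

theorem sum_Ico_gaps_sq_le (hY : Antitone Y) {a b : ℕ} (hab : a ≤ b) :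
    ∑ k ∈ Ico a b, (Y k - Y (k + 1)) ^ 2 ≤ (Y a - Y b) ^ 2 := by
  have h := sum_Ico_sq_le_sq_sum (g := fun k => Y k - Y (k + 1))
    (fun k => sub_nonneg.2 (hY k.le_succ)) a b
  rwa [sum_Ico_gaps Y hab] at h

theorem Connected.sum_gaps_sq_le (hH : H.Connected) (hY : Antitone Y) :
    ∑ k ∈ range m, (Y k - Y (k + 1)) ^ 2 ≤
      (∑ i, ∑ j, if H.Adj i j then (Y i - Y j) ^ 2 else 0) / 2 := by
  rw [sum_adj_div_two_eq_sum_upEdges]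
  refine hH.sum_gaps_sq_le_sum_upEdges_sum_Ico.trans (sum_le_sum fun p hp => ?_)
  exact sum_Ico_gaps_sq_le hY (mem_filter.1 hp).2.2.le

theorem Connected.eq_pathGraph_of_sum_gaps_sq_eq (hH : H.Connected) (hY : Antitone Y)
    (hpos : ∀ k < m, 0 < Y k - Y (k + 1))
    (h : ∑ k ∈ range m, (Y k - Y (k + 1)) ^ 2 =
      (∑ i, ∑ j, if H.Adj i j then (Y i - Y j) ^ 2 else 0) / 2) :
    H = pathGraph (m + 1) := by
  rw [sum_adj_div_two_eq_sum_upEdges] at h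
  have hle : ∀ p ∈ H.upEdges,
      ∑ k ∈ Ico (p.1 : ℕ) p.2, (Y k - Y (k + 1)) ^ 2 ≤ (Y p.1 - Y p.2) ^ 2 :=
    fun p hp => sum_Ico_gaps_sq_le hY (mem_filter.1 hp).2.2.le
  have heq := (sum_eq_sum_iff_of_le hle).1
    (le_antisymm (sum_le_sum hle) (h ▸ hH.sum_gaps_sq_le_sum_upEdges_sum_Ico))
  have hstep : ∀ i j, H.Adj i j → i < j → (j : ℕ) = i + 1 := by
    intro i j hij hlt
    have h1 := heq (i, j) (by simp [upEdges, hij, hlt])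
    refine eq_succ_of_sum_Ico_sq_eq (g := fun k => Y k - Y (k + 1))
      (fun k => sub_nonneg.2 (hY k.le_succ)) hlt (fun k hk => hpos k ?_) ?_
    · have := (mem_Ico.1 hk).2
      omega
    · rw [sum_Ico_gaps Y hlt.le]
      exact h1
  have hpath : ∀ i j : Fin (m + 1), (i : ℕ) + 1 = j → H.Adj i j := by
    intro i j hij
    obtain ⟨a, b, hab, ha, hb⟩ := hH.exists_adj_across (k := i) (by omega)
    have := hstep a b hab (Fin.lt_def.2 (by omega))
    rwa [show i = a from Fin.ext (by omega), show j = b from Fin.ext (by omega)]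
  ext i j
  rw [pathGraph_adj]
  constructor
  · intro hij
    rcases lt_trichotomy i j with hlt | rfl | hlt
    · exact .inl (hstep i j hij hlt).symm
    · exact absurd hij (H.loopless.irrefl i)
    · exact .inr (hstep j i hij.symm hlt).symm
  · rintro (hij | hij)
    · exact hpath i j hij
    · exact (hpath j i hij).symm

end SortedEnergy

section UpperBound

variable {V : Type*} [Fintype V] {m : ℕ}

theorem Connected.two_mul_sub_gramForm_le_pathMaxDiag {H : SimpleGraph (Fin (m + 1))}
    [DecidableRel H.Adj] (hH : H.Connected) {Y : ℕ → ℝ} (hY : Antitone Y) :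
    2 * Y 0 - H.gramForm (fun i => Y i) ≤ pathMaxDiag m := by
  have h1 := hH.sum_gaps_sq_le hY
  have h2 := two_mul_sub_sum_gaps_sq Y m
  have h3 : 0 ≤ ∑ k ∈ range m, (Y k - Y (k + 1) - ((m : ℝ) - k) / (m + 1)) ^ 2 := by positivity
  have h4 := sq_nonneg (∑ k ∈ range (m + 1), Y k - 1 / (m + 1))
  rw [gramForm, Fin.sum_univ_eq_sum_range Y]
  linarith

theorem Connected.eq_pathGraph_of_two_mul_sub_gramForm_eq {H : SimpleGraph (Fin (m + 1))}
    [DecidableRel H.Adj] (hH : H.Connected) {Y : ℕ → ℝ} (hY : Antitone Y)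
    (h : 2 * Y 0 - H.gramForm (fun i => Y i) = pathMaxDiag m) : H = pathGraph (m + 1) := by
  have h1 := hH.sum_gaps_sq_le hY
  have h2 := two_mul_sub_sum_gaps_sq Y m
  have h3 : 0 ≤ ∑ k ∈ range m, (Y k - Y (k + 1) - ((m : ℝ) - k) / (m + 1)) ^ 2 := by positivity
  have h4 := sq_nonneg (∑ k ∈ range (m + 1), Y k - 1 / (m + 1))
  rw [gramForm, Fin.sum_univ_eq_sum_range Y] at h
  refine hH.eq_pathGraph_of_sum_gaps_sq_eq hY (fun k hk => ?_) (by linarith)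
  have h5 : ∑ k ∈ range m, (Y k - Y (k + 1) - ((m : ℝ) - k) / (m + 1)) ^ 2 = 0 := by linarith
  have h6 := (sum_eq_zero_iff_of_nonneg fun k _ => sq_nonneg _).1 h5 k (mem_range.2 hk)
  rw [pow_eq_zero_iff two_ne_zero, sub_eq_zero] at h6
  rw [h6]
  have : (k : ℝ) < m := by exact_mod_cast hk
  exact div_pos (by linarith) (by positivity)

theorem exists_equiv_antitone (hV : Fintype.card V = m + 1) (x : V → ℝ) :
    ∃ (τ : Fin (m + 1) ≃ V) (Y : ℕ → ℝ), Antitone Y ∧ ∀ i : Fin (m + 1), Y i = x (τ i) := by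
  let e := Fintype.equivFinOfCardEq hV
  let f : Fin (m + 1) → ℝ := fun k => -x (e.symm k)
  refine ⟨(Tuple.sort f).trans e.symm,
    fun k => x (e.symm (Tuple.sort f ⟨min k m, by omega⟩)), fun a b hab => ?_, fun i => ?_⟩
  · have := Tuple.monotone_sort f (a := ⟨min a m, by omega⟩) (b := ⟨min b m, by omega⟩)
      (Fin.mk_le_mk.2 (by omega))
    simpa [f] using this
  · have : (⟨min i m, by omega⟩ : Fin (m + 1)) = i := Fin.ext (by simp; omega)
    simp [this]

variable [DecidableEq V] {G : SimpleGraph V}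

theorem Connected.gramMatrix_apply_self_le_pathMaxDiag (hG : G.Connected)
    (hV : Fintype.card V = m + 1) (i : V) :
    gramMatrix G i i ≤ pathMaxDiag m ∧
      (gramMatrix G i i = pathMaxDiag m → Nonempty (G ≃g pathGraph (m + 1))) := by
  classical
  obtain ⟨τ, Y, hY, hYx⟩ := exists_equiv_antitone hV ((gramMatrix G).col i)
  let φ : G.comap τ ≃g G := Iso.comap τ G
  have hH : (G.comap τ).Connected := φ.connected_iff.2 hG
  have h1 : (G.comap τ).gramForm (fun i => Y i) = G.gramForm ((gramMatrix G).col i) := by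
    rw [← φ.gramForm_comp]
    congr 1
    ext j
    exact hYx j
  have h2 : (gramMatrix G).col i i ≤ Y 0 := by
    have := hYx (τ.symm i)
    rw [τ.apply_symm_apply] at this
    rw [← this]
    exact hY (Nat.zero_le _)
  have h3 := hG.gramMatrix_apply_self i
  have h4 := hH.two_mul_sub_gramForm_le_pathMaxDiag hY
  refine ⟨by linarith, fun h => ?_⟩
  have h5 := hH.eq_pathGraph_of_two_mul_sub_gramForm_eq hY (by linarith)
  rw [← h5]
  exact ⟨φ.symm⟩

theorem sum_adj_pathGraph_div_two [DecidableRel (pathGraph (m + 1)).Adj] (Y : ℕ → ℝ) :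
    (∑ i : Fin (m + 1), ∑ j : Fin (m + 1),
      if (pathGraph (m + 1)).Adj i j then (Y i - Y j) ^ 2 else 0) / 2 =
      ∑ k ∈ range m, (Y k - Y (k + 1)) ^ 2 := by
  rw [sum_adj_div_two_eq_sum_upEdges]
  symm
  rw [← Fin.sum_univ_eq_sum_range (fun k => (Y k - Y (k + 1)) ^ 2)]
  refine sum_bij (fun k _ => (k.castSucc, k.succ)) (fun k _ => ?_) (fun a _ b _ h => ?_)
    (fun p hp => ?_) (fun k _ => by simp)
  · simp [upEdges, pathGraph_adj]
  · simpa using congrArg Prod.fst h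
  · obtain ⟨i, j⟩ := p
    simp only [upEdges, mem_filter, mem_univ, true_and, pathGraph_adj, Fin.lt_def] at hp
    refine ⟨⟨i, by omega⟩, mem_univ _, ?_⟩
    ext <;> simp
    omega

theorem exists_two_mul_sub_gramForm_pathGraph_eq (m : ℕ)
    [DecidableRel (pathGraph (m + 1)).Adj] :
    ∃ Y : ℕ → ℝ, 2 * Y 0 - (pathGraph (m + 1)).gramForm (fun i => Y i) = pathMaxDiag m := by
  let Z : ℕ → ℝ := fun k => -∑ j ∈ range k, ((m : ℝ) - j) / (m + 1)
  let a : ℝ := (1 / (m + 1) - ∑ k ∈ range (m + 1), Z k) / (m + 1)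
  refine ⟨fun k => a + Z k, ?_⟩
  have hgap (k : ℕ) : a + Z k - (a + Z (k + 1)) = ((m : ℝ) - k) / (m + 1) := by
    simp only [Z, sum_range_succ]
    ring
  have hsum : ∑ k ∈ range (m + 1), (a + Z k) = 1 / (m + 1) := by
    rw [sum_add_distrib, sum_const, card_range, nsmul_eq_mul]
    simp only [a]
    push_cast
    field_simp
    ring
  have h := two_mul_sub_sum_gaps_sq (fun k => a + Z k) m
  rw [gramForm, sum_adj_pathGraph_div_two (fun k => a + Z k),
    Fin.sum_univ_eq_sum_range (fun k => a + Z k), h, hsum]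
  simp [hgap]

theorem Iso.pathMaxDiag_le_maxDiag (φ : G ≃g pathGraph (m + 1)) :
    pathMaxDiag m ≤ maxDiag G := by
  classical
  obtain ⟨Y, hY⟩ := exists_two_mul_sub_gramForm_pathGraph_eq m
  have hG : G.Connected := φ.connected_iff.2 (pathGraph_connected m)
  have h := hG.two_mul_sub_gramForm_le (φ.symm 0) (fun i => Y (φ i))
  rw [φ.gramForm_comp (fun i => Y i), φ.apply_symm_apply, Fin.val_zero, hY] at h
  exact h.trans (G.gramMatrix_apply_self_le_maxDiag _)

theorem Connected.maxDiag_le_pathMaxDiag (hG : G.Connected) (hV : Fintype.card V = m + 1) :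
    maxDiag G ≤ pathMaxDiag m := by
  have := hG.nonempty
  exact ciSup_le fun i => (hG.gramMatrix_apply_self_le_pathMaxDiag hV i).1

theorem Connected.maxDiag_eq_pathMaxDiag_iff (hG : G.Connected)
    (hV : Fintype.card V = m + 1) :
    maxDiag G = pathMaxDiag m ↔ Nonempty (G ≃g pathGraph (m + 1)) := by
  have := hG.nonempty
  refine ⟨fun h => ?_, fun ⟨φ⟩ => (hG.maxDiag_le_pathMaxDiag hV).antisymm
    φ.pathMaxDiag_le_maxDiag⟩
  obtain ⟨i, hi⟩ := G.exists_gramMatrix_apply_self_eq_maxDiag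
  exact (hG.gramMatrix_apply_self_le_pathMaxDiag hV i).2 (hi.trans h)

end UpperBound

theorem maxDiag_pathGraph (m : ℕ) : maxDiag (pathGraph (m + 1)) = pathMaxDiag m :=
  ((pathGraph_connected m).maxDiag_eq_pathMaxDiag_iff (Fintype.card_fin _)).2 ⟨Iso.refl⟩

end SimpleGraph

/-- For a connected graph `G` on `n` vertices,
`1/n ≤ K̄(G) ≤ K̄(P_n)`, with left equality iff `G` is complete and right
equality iff `G` is isomorphic to the path `P_n`. -/
theorem stmt_17 {V : Type*} [Fintype V] [DecidableEq V]
    (G : SimpleGraph V) (hG : G.Connected) (n : ℕ) (hn : n = Fintype.card V) :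
    (1 / (n : ℝ) ≤ maxDiag G ∧ maxDiag G ≤ maxDiag (SimpleGraph.pathGraph n)) ∧
      (maxDiag G = 1 / (n : ℝ) ↔ G = ⊤) ∧
      (maxDiag G = maxDiag (SimpleGraph.pathGraph n) ↔
        Nonempty (G ≃g SimpleGraph.pathGraph n)) := by
  have := hG.nonempty
  obtain ⟨m, hm⟩ : ∃ m, Fintype.card V = m + 1 := Nat.exists_eq_add_one.2 Fintype.card_pos
  refine ⟨⟨?_, ?_⟩, ?_, ?_⟩
  · rw [hn]
    exact hG.one_div_card_le_maxDiag
  · obtain rfl : n = m + 1 := hn.trans hm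
    rw [SimpleGraph.maxDiag_pathGraph]
    exact hG.maxDiag_le_pathMaxDiag hm
  · rw [hn]
    exact hG.maxDiag_eq_one_div_card_iff
  · obtain rfl : n = m + 1 := hn.trans hm
    rw [SimpleGraph.maxDiag_pathGraph]
    exact hG.maxDiag_eq_pathMaxDiag_iff hm
end

section
/- Let T be a tree on n vertices with Gram matrix K = (L + J)⁻¹, let p ≥ 2, and let u and v be vertices of T at graph distance d(u,v) = p − 1. Then K_{u,v} ≥ 1/n − p/n² + 1/n² − ((p−1)/n²)·((3n − 2p + 3)(p − 2)/6 + ⌈(n − p + 2)/2⌉·⌊(n − p + 2)/2⌋). -/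
namespace SimpleGraph

variable {V : Type*} {T : SimpleGraph V}

/-- In a tree, at most one neighbour of `x` is closer to `w` than `x` is. -/
lemma IsTree.eq_of_adj_of_dist_add_one (hT : T.IsTree) {w x y z : V} (hxy : T.Adj x y)
    (hxz : T.Adj x z) (hy : T.dist w y + 1 = T.dist w x) (hz : T.dist w z + 1 = T.dist w x) :
    y = z := by
  obtain ⟨p, hp⟩ := hT.1.exists_walk_length_eq_dist w y
  obtain ⟨q, hq⟩ := hT.1.exists_walk_length_eq_dist w z
  have hp' : (p.concat hxy.symm).IsPath :=
    Walk.isPath_of_length_eq_dist _ (by rw [Walk.length_concat, hp, hy])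
  have hq' : (q.concat hxz.symm).IsPath :=
    Walk.isPath_of_length_eq_dist _ (by rw [Walk.length_concat, hq, hz])
  have h := congrArg Walk.penultimate ((hT.existsUnique_path w x).unique hp' hq')
  simpa using h

/-- In a tree, every vertex other than `w` has a neighbour closer to `w`. -/
lemma Connected.exists_adj_dist_add_one (hT : T.Connected) {w x : V} (hne : x ≠ w) :
    ∃ y, T.Adj x y ∧ T.dist w y + 1 = T.dist w x := by
  obtain ⟨p, hp⟩ := hT.exists_walk_length_eq_dist x w
  cases p with
  | nil => exact absurd rfl hne
  | @cons _ y _ h q =>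
    refine ⟨y, h, ?_⟩
    have h1 : T.dist y w ≤ q.length := dist_le q
    have h2 : T.dist x w ≤ T.dist x y + T.dist y w := hT.dist_triangle
    have h3 := dist_eq_one_iff_adj.2 h
    rw [Walk.length_cons] at hp
    rw [dist_comm (u := w), dist_comm (u := w)]
    omega

/-- If every step from `x` towards `v` leads away from `u`, then `x` lies between `u` and `v`. -/
lemma IsTree.dist_add_dist_of_forall_adj (hT : T.IsTree) {u v x : V}
    (h : ∀ y, T.Adj x y → T.dist v y + 1 = T.dist v x → T.dist u y = T.dist u x + 1) :
    T.dist u x + T.dist v x = T.dist u v := by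
  induction hk : T.dist v x generalizing x with
  | zero =>
    obtain rfl := (hT.1.dist_eq_zero_iff).1 hk
    rfl
  | succ k ih =>
    have hne : x ≠ v := by
      rintro rfl
      simp at hk
    obtain ⟨y, hxy, hy⟩ := hT.1.exists_adj_dist_add_one hne
    have huy := h y hxy hy
    have := ih (x := y) (fun z hyz hz => by
      rcases hT.dist_eq_dist_add_one_of_adj u hyz with h' | h'
      · have := hT.eq_of_adj_of_dist_add_one hyz hxy.symm h'.symm huy.symm
        subst this
        omega
      · exact h') (by omega)
    omega

/-- Any three vertices of a tree have a median. -/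
lemma IsTree.exists_median (hT : T.IsTree) (u v x : V) :
    ∃ z, T.dist u z + T.dist v z = T.dist u v ∧ T.dist u x = T.dist u z + T.dist z x ∧
      T.dist v x = T.dist v z + T.dist z x := by
  induction hk : T.dist u x generalizing x with
  | zero =>
    obtain rfl := (hT.1.dist_eq_zero_iff).1 hk
    exact ⟨u, by simp [dist_comm], by simp, by simp⟩
  | succ k ih =>
    by_cases h : ∃ y, T.Adj x y ∧ T.dist u y + 1 = T.dist u x ∧ T.dist v y + 1 = T.dist v x
    · obtain ⟨y, hxy, hu, hv⟩ := h
      obtain ⟨z, h1, h2, h3⟩ := ih y (by omega)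
      have h4 : T.dist z x ≤ T.dist z y + T.dist y x := hT.1.dist_triangle
      have h5 : T.dist u x ≤ T.dist u z + T.dist z x := hT.1.dist_triangle
      have h6 := dist_eq_one_iff_adj.2 hxy.symm
      exact ⟨z, h1, by omega, by omega⟩
    · refine ⟨x, hT.dist_add_dist_of_forall_adj fun y hxy hy => ?_, by simp [hk], by simp⟩
      rcases hT.dist_eq_dist_add_one_of_adj u hxy with h' | h'
      · exact absurd ⟨y, hxy, h'.symm, hy⟩ h
      · exact h'

/-- In a tree, a vertex between `u` and `v` lies on the path from `u` to `v`. -/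
lemma IsTree.eq_getVert_of_dist_add_dist (hT : T.IsTree) {u v z : V} {p : T.Walk u v}
    (hp : p.IsPath) (hz : T.dist u z + T.dist v z = T.dist u v) :
    z = p.getVert (T.dist u z) := by
  obtain ⟨q, hq⟩ := hT.1.exists_walk_length_eq_dist u z
  obtain ⟨r, hr⟩ := hT.1.exists_walk_length_eq_dist z v
  have hqr : (q.append r).IsPath :=
    Walk.isPath_of_length_eq_dist _ (by rw [Walk.length_append, hq, hr, ← hz, dist_comm (u := z)])
  rw [(hT.existsUnique_path u v).unique hp hqr, Walk.getVert_append, ← hq]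
  simp

lemma dist_getVert_getVert_le {u v : V} (p : T.Walk u v) {i j : ℕ} (hij : i ≤ j) :
    T.dist (p.getVert i) (p.getVert j) ≤ j - i := by
  have h := dist_le ((p.drop i).take (j - i))
  rw [Walk.take_length, Walk.drop_getVert, Nat.add_sub_cancel' hij] at h
  exact h.trans (min_le_left _ _)

lemma Connected.dist_getVert (hT : T.Connected) {u v : V} {p : T.Walk u v}
    (hp : p.length = T.dist u v) {i : ℕ} (hi : i ≤ T.dist u v) :
    T.dist u (p.getVert i) = i ∧ T.dist v (p.getVert i) + i = T.dist u v := by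
  have h1 := dist_getVert_getVert_le p (Nat.zero_le i)
  have h2 := dist_getVert_getVert_le p hi
  have h3 : T.dist u v ≤ T.dist u (p.getVert i) + T.dist (p.getVert i) v := hT.dist_triangle
  rw [← hp, Walk.getVert_length, hp] at h2
  rw [Walk.getVert_zero] at h1
  rw [dist_comm (u := v)]
  omega

section Gram

variable [Fintype V] [DecidableEq V] [DecidableRel T.Adj]

lemma IsTree.sum_neighborFinset_dist (hT : T.IsTree) (v x : V) :
    ∑ y ∈ T.neighborFinset x, (T.dist v y : ℝ) =
      T.degree x * T.dist v x + T.degree x - 2 + if x = v then 2 else 0 := by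
  have h : ∀ y ∈ T.neighborFinset x, (T.dist v y : ℝ) =
      T.dist v x + 1 - 2 * if T.dist v y + 1 = T.dist v x then 1 else 0 := by
    intro y hy
    rw [mem_neighborFinset] at hy
    rcases hT.dist_eq_dist_add_one_of_adj v hy with h | h
    · rw [if_pos h.symm, h]
      push_cast
      ring
    · rw [if_neg (by omega), h]
      push_cast
      ring
  have hcard : (∑ y ∈ T.neighborFinset x, if T.dist v y + 1 = T.dist v x then (1 : ℝ) else 0) =
      if x = v then 0 else 1 := by
    split_ifs with hx
    · subst hx
      simp
    · obtain ⟨y, hxy, hy⟩ := hT.1.exists_adj_dist_add_one hx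
      rw [Finset.sum_eq_single y, if_pos hy]
      · intro z hz hzy
        rw [mem_neighborFinset] at hz
        exact if_neg fun hz' => hzy (hT.eq_of_adj_of_dist_add_one hz hxy hz' hy)
      · intro h'
        exact absurd ((mem_neighborFinset _ _ _).2 hxy) h'
  rw [Finset.sum_congr rfl h, Finset.sum_sub_distrib, ← Finset.mul_sum, hcard, Finset.sum_const,
    card_neighborFinset_eq_degree, nsmul_eq_mul]
  split_ifs <;> ring

/-- The Laplacian applied to a column of the distance matrix of a tree. -/
lemma IsTree.lapMatrix_mulVec_dist (hT : T.IsTree) (v x : V) :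
    ∑ y, T.lapMatrix ℝ x y * T.dist v y = 2 - T.degree x - if x = v then 2 else 0 := by
  have h := T.lapMatrix_mulVec_apply (R := ℝ) x (fun y => (T.dist v y : ℝ))
  rw [hT.sum_neighborFinset_dist] at h
  rw [Matrix.mulVec, dotProduct] at h
  rw [h]
  ring

end Gram

end SimpleGraph

namespace SimpleGraph

/-- The Gram matrix of a tree in terms of graph distances. -/
lemma IsTree.sq_card_mul_inv_lapMatrix_add_one {V : Type*} [Fintype V] [DecidableEq V]
    {T : SimpleGraph V} [DecidableRel T.Adj] (hT : T.IsTree) (u v : V) :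
    (Fintype.card V : ℝ) ^ 2 * ((T.lapMatrix ℝ + Matrix.of fun _ _ => (1 : ℝ))⁻¹ : Matrix V V ℝ) u v =
      1 + (∑ x, ∑ y, ((T.dist u x : ℝ) + T.dist v y - T.dist u v - T.dist x y)) / 2 := by
  set n : ℝ := (Fintype.card V : ℝ) with hn
  have hn0 : n ≠ 0 := by
    have : Nonempty V := ⟨u⟩
    rw [hn]
    exact_mod_cast Fintype.card_ne_zero
  set t : V → ℝ := fun a => ∑ x, (T.dist a x : ℝ) with ht
  set S : ℝ := ∑ x, t x with hS
  let M : Matrix V V ℝ := Matrix.of fun a b =>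
    (1 + (n * t a + n * t b - n ^ 2 * T.dist b a - S) / 2) / n ^ 2
  have hL1 (x : V) : ∑ a, T.lapMatrix ℝ x a = 0 := by
    have h := congrFun (T.lapMatrix_mulVec_const_eq_zero (R := ℝ)) x
    simpa [Matrix.mulVec, dotProduct] using h
  have hLt (x : V) : ∑ a, T.lapMatrix ℝ x a * t a = n * (2 - T.degree x) - 2 := by
    have h (a : V) : T.lapMatrix ℝ x a * t a = ∑ w, T.lapMatrix ℝ x a * T.dist w a := by
      simp only [ht, Finset.mul_sum]
      exact Finset.sum_congr rfl fun w _ => by rw [dist_comm]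
    simp_rw [h]
    rw [Finset.sum_comm]
    simp_rw [hT.lapMatrix_mulVec_dist]
    simp [Finset.sum_sub_distrib, hn]
    ring
  have hS' (b : V) : ∑ a, (T.dist b a : ℝ) = t b := rfl
  have hM : (T.lapMatrix ℝ + Matrix.of fun _ _ => (1 : ℝ)) * M = 1 := by
    ext x b
    rw [Matrix.add_mul, Matrix.add_apply, Matrix.mul_apply, Matrix.mul_apply]
    have h1 : ∑ a, T.lapMatrix ℝ x a * M a b =
        ((1 + (n * t b - S) / 2) / n ^ 2) * (∑ a, T.lapMatrix ℝ x a) +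
        1 / (2 * n) * (∑ a, T.lapMatrix ℝ x a * t a) -
        1 / 2 * ∑ a, T.lapMatrix ℝ x a * T.dist b a := by
      simp only [Finset.mul_sum, ← Finset.sum_add_distrib, ← Finset.sum_sub_distrib]
      refine Finset.sum_congr rfl fun a _ => ?_
      simp only [M, Matrix.of_apply]
      field_simp
      ring
    have h2 : ∑ a, (Matrix.of fun _ _ => (1 : ℝ)) x a * M a b =
        n * ((1 + (n * t b - S) / 2) / n ^ 2) + 1 / (2 * n) * (∑ a, t a) -
        1 / 2 * ∑ a, (T.dist b a : ℝ) := by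
      have hc : n * ((1 + (n * t b - S) / 2) / n ^ 2) =
          ∑ _a : V, ((1 + (n * t b - S) / 2) / n ^ 2) := by
        simp [hn]
      rw [hc]
      simp only [Finset.mul_sum, ← Finset.sum_add_distrib, ← Finset.sum_sub_distrib]
      refine Finset.sum_congr rfl fun a _ => ?_
      simp only [M, Matrix.of_apply]
      field_simp
      ring
    rw [h1, h2, hL1, hLt, hT.lapMatrix_mulVec_dist, hS', ← hS, Matrix.one_apply]
    split_ifs <;> field_simp <;> ring
  rw [Matrix.inv_eq_right_inv hM]
  simp only [M, Matrix.of_apply, Finset.sum_sub_distrib, Finset.sum_add_distrib, Finset.sum_const,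
    Finset.card_univ, nsmul_eq_mul, ← Finset.mul_sum, ← hn, hS', ← hS, dist_comm (u := v) (v := u)]
  field_simp

end SimpleGraph

lemma sum_mul_sub_le_of_consecutive (m : ℕ) (N k δ : ℤ) (a : ℕ → ℤ) (hδ : δ = 0 ∨ δ = 1)
    (hN : N = m + 1 + 2 * k + δ)
    (ha : ∀ i j, i ≤ j → j < m → (j : ℤ) - i ≤ a j - a i) :
    ∑ i ∈ Finset.range m, a i * (N - a i) ≤
      ∑ i ∈ Finset.range m, ((i : ℤ) + (1 + k)) * (N - i - (1 + k)) := by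
  set e : ℕ → ℤ := fun i => a i - (i + 1 + k) with he
  have h1 : ∑ i ∈ Finset.range m, e i * (m - 1 - 2 * i) ≤ 0 := by
    have hr := Finset.sum_range_reflect (fun i => e i * ((m : ℤ) - 1 - 2 * i)) m
    have h2 : ∑ i ∈ Finset.range m, e i * ((m : ℤ) - 1 - 2 * i) +
        ∑ i ∈ Finset.range m, e (m - 1 - i) * ((m : ℤ) - 1 - 2 * ((m - 1 - i : ℕ) : ℤ)) ≤ 0 := by
      rw [← Finset.sum_add_distrib]
      refine Finset.sum_nonpos fun i hi => ?_
      rw [Finset.mem_range] at hi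
      have hc : ((m - 1 - i : ℕ) : ℤ) = m - 1 - i := by omega
      have hsum : e i * ((m : ℤ) - 1 - 2 * i) + e (m - 1 - i) *
          ((m : ℤ) - 1 - 2 * ((m - 1 - i : ℕ) : ℤ)) =
          (e i - e (m - 1 - i)) * (m - 1 - 2 * i) := by
        rw [hc]
        ring
      rw [hsum]
      rcases le_total i (m - 1 - i) with h | h
      · have := ha _ _ h (by omega)
        refine mul_nonpos_of_nonpos_of_nonneg ?_ (by omega)
        simp only [he]
        omega
      · have := ha _ _ h hi
        refine mul_nonpos_of_nonneg_of_nonpos ?_ (by omega)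
        simp only [he]
        omega
    linarith
  have h2 : ∑ i ∈ Finset.range m, (δ * e i - e i ^ 2) ≤ 0 := by
    refine Finset.sum_nonpos fun i _ => ?_
    rcases hδ with rfl | rfl
    · nlinarith [sq_nonneg (e i)]
    · rcases le_or_gt (e i) 0 with h | h
      · nlinarith [sq_nonneg (e i)]
      · nlinarith
  rw [← sub_nonpos, ← Finset.sum_sub_distrib]
  refine le_trans (le_of_eq ?_) (add_nonpos h1 h2)
  rw [← Finset.sum_add_distrib]
  refine Finset.sum_congr rfl fun i _ => ?_
  simp only [he, hN]
  ring

lemma sum_range_add_mul_sub (m : ℕ) (N c : ℝ) :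
    ∑ i ∈ Finset.range m, ((i : ℝ) + c) * (N - i - c) =
      m * c * (N - c) + (N - 2 * c) * m * (m - 1) / 2 - (m - 1) * m * (2 * m - 1) / 6 := by
  induction m with
  | zero => simp
  | succ m ih =>
    rw [Finset.sum_range_succ, ih]
    push_cast
    ring

lemma abs_sub_eq_sum_range {m s t : ℕ} (hs : s ≤ m) (ht : t ≤ m) :
    |(s : ℤ) - t| = ∑ i ∈ Finset.range m,
      ((if s ≤ i then 1 else 0) * (1 - if t ≤ i then 1 else 0) +
        (if t ≤ i then 1 else 0) * (1 - if s ≤ i then 1 else 0) : ℤ) := by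
  wlog hst : s ≤ t generalizing s t
  · rw [abs_sub_comm, this ht hs (le_of_not_ge hst)]
    exact Finset.sum_congr rfl fun i _ => add_comm _ _
  have h : ∀ i ∈ Finset.range m,
      ((if s ≤ i then 1 else 0) * (1 - if t ≤ i then 1 else 0) +
        (if t ≤ i then 1 else 0) * (1 - if s ≤ i then 1 else 0) : ℤ) =
      if s ≤ i ∧ i < t then 1 else 0 := by
    intro i _
    split_ifs <;> omega
  have hf : (Finset.range m).filter (fun i => s ≤ i ∧ i < t) = Finset.Ico s t := by
    ext i
    simp only [Finset.mem_filter, Finset.mem_range, Finset.mem_Ico]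
    omega
  rw [Finset.sum_congr rfl h, Finset.sum_boole, hf, Nat.card_Ico]
  rw [abs_of_nonpos (by omega)]
  push_cast [hst]
  ring

lemma sum_sum_abs_sub_eq {V : Type*} [Fintype V] (f : V → ℕ) (m : ℕ) (hf : ∀ x, f x ≤ m) :
    ∑ x, ∑ y, |(f x : ℤ) - f y| = 2 * ∑ i ∈ Finset.range m,
      ((Finset.univ.filter fun x => f x ≤ i).card : ℤ) *
        (Fintype.card V - (Finset.univ.filter fun x => f x ≤ i).card) := by
  simp_rw [fun x y => abs_sub_eq_sum_range (hf x) (hf y)]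
  rw [Finset.sum_congr rfl fun x _ => Finset.sum_comm, Finset.sum_comm, Finset.mul_sum]
  refine Finset.sum_congr rfl fun i _ => ?_
  simp_rw [Finset.sum_add_distrib]
  simp_rw [← Finset.mul_sum, ← Finset.sum_mul, Finset.sum_sub_distrib, Finset.sum_boole]
  simp [Finset.sum_sub_distrib, ← Finset.mul_sum]
  ring

namespace SimpleGraph

variable {V : Type*} [Fintype V] {T : SimpleGraph V}

/-- A sum over pairs of vertices of a tree is bounded below through the projection to the path
from `u` to `v`, where `a i` counts the vertices projecting to the first `i + 1` path vertices. -/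
lemma IsTree.exists_consecutive_le_sum_dist (hT : T.IsTree) {u v : V} {m : ℕ}
    (hm : T.dist u v = m) :
    ∃ a : ℕ → ℤ, (∀ i j, i ≤ j → j < m → (j : ℤ) - i ≤ a j - a i) ∧
      2 * ((Fintype.card V : ℤ) - (m + 1) -
        ∑ i ∈ Finset.range m, a i * (Fintype.card V - a i)) ≤
      ∑ x, ∑ y, ((T.dist u x : ℤ) + T.dist v y - T.dist u v - T.dist x y) := by
  classical
  obtain ⟨p, hpath, hp⟩ := hT.1.exists_path_of_dist u v
  choose z hz hzu hzv using hT.exists_median u v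
  set f : V → ℕ := fun x => T.dist u (z x) with hf
  have hfm (x : V) : f x ≤ m := by
    have := hz x
    simp only [hf]
    omega
  have hzp (x : V) : z x = p.getVert (f x) := hT.eq_getVert_of_dist_add_dist hpath (hz x)
  have hfp {i : ℕ} (hi : i ≤ m) : f (p.getVert i) = i := by
    have h := hT.1.dist_getVert hp (hm ▸ hi)
    have h1 := hz (p.getVert i)
    have h2 := hzu (p.getVert i)
    have h3 := hzv (p.getVert i)
    simp only [hf]
    omega
  set a : ℕ → ℤ := fun i => ((Finset.univ.filter fun x => f x ≤ i).card : ℤ) with ha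
  have ha_succ (i : ℕ) (hi : i < m) : a i + 1 ≤ a (i + 1) := by
    have h : (Finset.univ.filter fun x => f x ≤ i) ⊂ Finset.univ.filter fun x => f x ≤ i + 1 := by
      rw [Finset.ssubset_iff_of_subset (Finset.monotone_filter_right _ fun x _ hx => by omega)]
      refine ⟨p.getVert (i + 1), ?_, ?_⟩ <;> simp [hfp hi]
    have := Finset.card_lt_card h
    simp only [ha]
    omega
  have hcount : (Fintype.card V : ℤ) - (m + 1) ≤ ∑ x, (T.dist (z x) x : ℤ) := by
    have h1 : (Finset.univ.filter fun x => T.dist (z x) x = 0).card ≤ m + 1 := by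
      rw [← Finset.card_range (m + 1)]
      refine Finset.card_le_card_of_injOn f (fun x _ => ?_) fun x hx y hy hxy => ?_
      · simpa using Nat.lt_succ_of_le (hfm x)
      · simp only [Finset.coe_filter, Finset.mem_univ, true_and, Set.mem_ofPred_eq,
          hT.1.dist_eq_zero_iff] at hx hy
        rw [← hx, ← hy, hzp x, hzp y, hxy]
    have h2 : ∑ x, ((1 : ℤ) - if T.dist (z x) x = 0 then 1 else 0) ≤
        ∑ x, (T.dist (z x) x : ℤ) := by
      refine Finset.sum_le_sum fun x _ => ?_
      split_ifs <;> omega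
    rw [Finset.sum_sub_distrib, Finset.sum_boole] at h2
    simp only [Finset.sum_const, Finset.card_univ, nsmul_eq_mul, mul_one] at h2
    omega
  refine ⟨a, fun i j hij => ?_, ?_⟩
  · induction j, hij using Nat.le_induction with
    | base => simp
    | succ j hij ih =>
      intro hj
      have h1 := ih (by omega)
      have h2 := ha_succ j (by omega)
      push_cast
      linarith
  have habs := sum_sum_abs_sub_eq f m hfm
  have hpt (x y : V) : (if x = y then 2 * (T.dist (z x) x : ℤ) else 0) - |(f x : ℤ) - f y| ≤
      T.dist (z x) x + T.dist (z y) y - T.dist x y := by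
    split_ifs with hxy
    · subst hxy
      simp
      linarith
    · have h1 : T.dist x y ≤ T.dist x (z x) + T.dist (z x) y := hT.1.dist_triangle
      have h2 : T.dist (z x) y ≤ T.dist (z x) (z y) + T.dist (z y) y := hT.1.dist_triangle
      rw [dist_comm (u := x) (v := z x)] at h1
      have h3 : (T.dist (z x) (z y) : ℤ) ≤ |(f x : ℤ) - f y| := by
        rw [hzp x, hzp y]
        rcases le_total (f x) (f y) with h | h
        · have := dist_getVert_getVert_le p h
          rw [abs_of_nonpos (by omega)]
          omega
        · have := dist_getVert_getVert_le p h
          rw [dist_comm, abs_of_nonneg (by omega)]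
          omega
      omega
  have hsum := Finset.sum_le_sum fun x (_ : x ∈ Finset.univ) =>
    Finset.sum_le_sum fun y (_ : y ∈ Finset.univ) => hpt x y
  simp only [Finset.sum_sub_distrib, Finset.sum_ite_eq, Finset.mem_univ, if_true] at hsum
  rw [← Finset.mul_sum, habs] at hsum
  have hswap : ∑ x, ∑ y, ((T.dist u x : ℤ) + T.dist v y - T.dist u v - T.dist x y) =
      ∑ x, ∑ y, ((T.dist (z x) x : ℤ) + T.dist (z y) y - T.dist x y) := by
    have h (x y : V) : (T.dist u x : ℤ) + T.dist v y - T.dist u v - T.dist x y =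
        (T.dist (z x) x + T.dist (z y) y - T.dist x y) + ((f x : ℤ) - f y) := by
      have h1 := hz y
      have h2 := hzu x
      have h3 := hzv y
      simp only [hf]
      omega
    simp_rw [h, Finset.sum_add_distrib, Finset.sum_sub_distrib]
    rw [add_eq_left, sub_eq_zero]
    exact Finset.sum_comm
  rw [hswap]
  simp only [Finset.sum_sub_distrib]
  linarith

end SimpleGraph

/-- Lower bound for the Gram-matrix entry `K_{u,v} = ((L + J)⁻¹)_{u,v}` of a
tree `T` on `n` vertices at two vertices `u, v` at distance `p − 1`. -/
theorem stmt_19 {V : Type*} [Fintype V] [DecidableEq V]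
    (T : SimpleGraph V) [DecidableRel T.Adj] (hT : T.IsTree) (n : ℕ)
    (hn : n = Fintype.card V)
    (K : Matrix V V ℝ)
    (hK : K = (T.lapMatrix ℝ + Matrix.of fun _ _ => (1 : ℝ))⁻¹)
    (p : ℕ) (hp : 2 ≤ p) (u v : V) (hd : T.dist u v = p - 1) :
    1 / (n : ℝ) - (p : ℝ) / (n : ℝ) ^ 2 + 1 / (n : ℝ) ^ 2
        - (((p : ℝ) - 1) / (n : ℝ) ^ 2) *
          ((3 * (n : ℝ) - 2 * (p : ℝ) + 3) * ((p : ℝ) - 2) / 6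
            + (⌈((n : ℝ) - (p : ℝ) + 2) / 2⌉ : ℝ)
              * (⌊((n : ℝ) - (p : ℝ) + 2) / 2⌋ : ℝ))
      ≤ K u v := by
  obtain ⟨m, rfl⟩ : ∃ m, p = m + 1 := ⟨p - 1, by omega⟩
  rw [Nat.add_sub_cancel] at hd
  have hmn : m + 1 ≤ n := by
    obtain ⟨q, hq, hql⟩ := hT.1.exists_path_of_dist u v
    have := hq.length_lt
    omega
  obtain ⟨k, δ, hδ, hnk⟩ : ∃ k δ : ℕ, (δ = 0 ∨ δ = 1) ∧ n = m + 1 + 2 * k + δ :=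
    ⟨(n - (m + 1)) / 2, (n - (m + 1)) % 2, by omega, by omega⟩
  have hgram := hT.sq_card_mul_inv_lapMatrix_add_one u v
  rw [← hK, ← hn] at hgram
  obtain ⟨a, ha, hle⟩ := hT.exists_consecutive_le_sum_dist hd
  rw [← hn] at hle
  have hbound := sum_mul_sub_le_of_consecutive m n k δ a (by omega) (by omega) ha
  have hle' := hle.trans' (mul_le_mul_of_nonneg_left (sub_le_sub_left hbound _) zero_le_two)
  have hleR : (2 : ℝ) * ((n : ℝ) - (m + 1) -
      ∑ i ∈ Finset.range m, ((i : ℝ) + (1 + k)) * (n - i - (1 + k))) ≤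
      ∑ x, ∑ y, ((T.dist u x : ℝ) + T.dist v y - T.dist u v - T.dist x y) := by
    exact_mod_cast hle'
  rw [sum_range_add_mul_sub] at hleR
  have hnR : (n : ℝ) = m + 1 + 2 * k + δ := by exact_mod_cast hnk
  have hfloor : ⌊((n : ℝ) - ((m + 1 : ℕ) : ℝ) + 2) / 2⌋ = (k : ℤ) + 1 := by
    rw [Int.floor_eq_iff, hnR]
    push_cast
    rcases hδ with rfl | rfl <;> constructor <;> push_cast <;> linarith
  have hceil : ⌈((n : ℝ) - ((m + 1 : ℕ) : ℝ) + 2) / 2⌉ = (k : ℤ) + 1 + δ := by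
    rw [Int.ceil_eq_iff, hnR]
    push_cast
    rcases hδ with rfl | rfl <;> constructor <;> push_cast <;> linarith
  have hn0 : (0 : ℝ) < n := by
    have : 0 < n := by omega
    exact_mod_cast this
  rw [hfloor, hceil]
  refine le_of_mul_le_mul_left ?_ (pow_pos hn0 2)
  rw [hgram]
  refine le_trans (le_of_eq ?_) (add_le_add_right ((le_div_iff₀' two_pos).2 hleR) 1)
  field_simp
  rw [hnR]
  rcases hδ with rfl | rfl <;> push_cast <;> ring
end
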